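/- For every affine homeomorphism φ (an affine map of ℝ² with invertible linear part) defined on an open square Q₀ ⊂ ℝ² with edges parallel to the coordinate axes, and for every n ∈ ℕ with n ≥ 1, there exist a piecewise affine homeomorphism φ_n : Q₀ → φ(Q₀) and a set F_n ⊆ Q₀ which is a finite union of pairwise disjoint open triangles such that: (1) |Var(φ_n,Q₀) − Var(φ,Q₀)| ≤ (1/n)·Var(φ,Q₀); (2) the continuous extensions of φ_n and φ to the closure of Q₀ agree on ∂Q₀; (3) |F_n|/|Q₀| < 1/n and |φ_n(F_n)|/|φ(Q₀)| > 1 − 1/n. -/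

import Mathlib

open MeasureTheory Set
open scoped ENNReal

noncomputable section

abbrev Plane := EuclideanSpace ℝ (Fin 2)

/-- The open unit square `(0,1)²`. -/
def unitSq : Set Plane := {x | 0 < x 0 ∧ x 0 < 1 ∧ 0 < x 1 ∧ x 1 < 1}

/-- Standard basis vectors of the plane. -/
def e2 (i : Fin 2) : Plane := EuclideanSpace.single i 1

/-- The set of approximating values in the definition of the variation of `f` on `U`:
integrals against `C¹_c` test fields `φ = (φ₁, φ₂)` all of whose four components are
bounded by `1` in absolute value. -/
def varSet (f : Plane → Plane) (U : Set Plane) : Set ℝ :=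
  {v | ∃ φ : Plane → Plane × Plane,
    ContDiff ℝ 1 φ ∧ HasCompactSupport φ ∧ tsupport φ ⊆ U ∧
    (∀ x i, |(φ x).1 i| ≤ 1 ∧ |(φ x).2 i| ≤ 1) ∧
    v = ∫ x in U, ((f x 0) * (fderiv ℝ (fun y => (φ y).1 0) x (e2 0)
                    + fderiv ℝ (fun y => (φ y).1 1) x (e2 1))
        + (f x 1) * (fderiv ℝ (fun y => (φ y).2 0) x (e2 0)
                    + fderiv ℝ (fun y => (φ y).2 1) x (e2 1)))}

/-- The variation of `f` in `U`. -/
def Var (f : Plane → Plane) (U : Set Plane) : ℝ := sSup (varSet f U)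

/-- `f` is a `BV` map on `U`. -/
def IsBV (f : Plane → Plane) (U : Set Plane) : Prop :=
  IntegrableOn f U volume ∧ BddAbove (varSet f U)

/-- `f` is a homeomorphism of `U` onto `V`, with inverse `g`. -/
def IsHomeoOn (f g : Plane → Plane) (U V : Set Plane) : Prop :=
  BijOn f U V ∧ ContinuousOn f U ∧ InvOn g f U V ∧ ContinuousOn g V

/-- `f` (as a total function, representing its own continuous extension) extends
continuously to the closure of the unit square, with `f = Id` on the boundary. -/
def ExtendsToId (f : Plane → Plane) : Prop :=
  ContinuousOn f (closure unitSq) ∧ EqOn f id (frontier unitSq)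

/-- The space `X` of `BV` homeomorphisms of the unit square fixing the boundary with
variation smaller than `M`; an element is a pair (homeomorphism, inverse). -/
def X (M : ℝ) : Set ((Plane → Plane) × (Plane → Plane)) :=
  {p | IsHomeoOn p.1 p.2 unitSq unitSq ∧ ExtendsToId p.1 ∧
    IsBV p.1 unitSq ∧ Var p.1 unitSq < M}

/-- Sup distance `‖f - g‖_∞` over the set `U`. -/
def supDist (f g : Plane → Plane) (U : Set Plane) : ℝ := ⨆ x : U, dist (f x) (g x)

/-- The distance `d` on `X`. -/
def dX (M : ℝ) (p q : (Plane → Plane) × (Plane → Plane)) : ℝ :=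
  supDist p.1 q.1 unitSq + supDist p.2 q.2 unitSq +
    |1 / (M - Var p.1 unitSq) - 1 / (M - Var q.1 unitSq)|

/-- `A` is open in the metric space `(X, d)`. -/
def OpenInX (M : ℝ) (A : Set ((Plane → Plane) × (Plane → Plane))) : Prop :=
  A ⊆ X M ∧ ∀ p ∈ A, ∃ ε > 0, ∀ q ∈ X M, dX M p q < ε → q ∈ A

/-- `A` is dense in the metric space `(X, d)`. -/
def DenseInX (M : ℝ) (A : Set ((Plane → Plane) × (Plane → Plane))) : Prop :=
  A ⊆ X M ∧ ∀ p ∈ X M, ∀ ε > 0, ∃ q ∈ A, dX M p q < ε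

/-- An open triangle in the plane. -/
def IsOpenTriangle (T : Set Plane) : Prop :=
  ∃ a b c : Plane, T = interior (convexHull ℝ {a, b, c})

/-- A finite union of pairwise disjoint open triangles. -/
def FinUnionTriangles (E : Set Plane) : Prop :=
  ∃ (k : ℕ) (T : Fin k → Set Plane), (∀ i, IsOpenTriangle (T i)) ∧
    (∀ i j, i ≠ j → Disjoint (T i) (T j)) ∧ E = ⋃ i, T i

/-- The set `A` of homeomorphisms mapping a null set onto a set of full measure. -/
def Afull (M : ℝ) : Set ((Plane → Plane) × (Plane → Plane)) :=
  {p ∈ X M | ∃ E ⊆ unitSq, volume E = 0 ∧ volume (p.1 '' E) = 1}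

/-- The set `A_n`. -/
def An (M : ℝ) (n : ℕ) : Set ((Plane → Plane) × (Plane → Plane)) :=
  {p ∈ X M | ∃ E ⊆ unitSq, FinUnionTriangles E ∧
    volume E < 1 / (n : ℝ≥0∞) ∧ 1 - 1 / (n : ℝ≥0∞) < volume (p.1 '' E)}

/-- An open square with edges parallel to the coordinate axes. -/
def IsOpenAxisSquare (Q0 : Set Plane) : Prop :=
  ∃ a b s : ℝ, 0 < s ∧
    Q0 = {x | a < x 0 ∧ x 0 < a + s ∧ b < x 1 ∧ x 1 < b + s}

/-- A closed triangle in the plane. -/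
def IsClosedTriangle (T : Set Plane) : Prop :=
  ∃ a b c : Plane, T = convexHull ℝ {a, b, c}

/-- `h` is (finitely) piecewise affine on the open square `Q0`: there is a finite family
of closed triangles with pairwise disjoint interiors covering the closure of `Q0`, with
`h` affine on (the intersection of `Q0` with) each of them. -/
def PiecewiseAffineOn (h : Plane → Plane) (Q0 : Set Plane) : Prop :=
  ∃ (k : ℕ) (T : Fin k → Set Plane), (∀ i, IsClosedTriangle (T i)) ∧
    (∀ i j, i ≠ j → Disjoint (interior (T i)) (interior (T j))) ∧
    (⋃ i, T i) = closure Q0 ∧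
    ∀ i, ∃ A : Plane →ᵃ[ℝ] Plane, EqOn h (⇑A) (Q0 ∩ T i)

open scoped NNReal

/-- The point of the plane with coordinates `x`, `y`. -/
def pt (x y : ℝ) : Plane := !₂[x, y]

@[simp] lemma pt_zero (x y : ℝ) : pt x y 0 = x := by simp [pt]

@[simp] lemma pt_one (x y : ℝ) : pt x y 1 = y := by simp [pt]

lemma plane_ext {p q : Plane} (h0 : p 0 = q 0) (h1 : p 1 = q 1) : p = q := by
  ext i; fin_cases i
  · exact h0
  · exact h1

@[simp] lemma e2_zero_zero : e2 0 0 = 1 := by simp [e2]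
@[simp] lemma e2_zero_one : e2 0 1 = 0 := by simp [e2]
@[simp] lemma e2_one_zero : e2 1 0 = 0 := by simp [e2]
@[simp] lemma e2_one_one : e2 1 1 = 1 := by simp [e2]

@[simp] lemma norm_e2 (i : Fin 2) : ‖e2 i‖ = 1 := by simp [e2]

lemma continuous_coord (i : Fin 2) : Continuous fun p : Plane => p i := by fun_prop

/-- The open box `(a, b) × (c, d)`. -/
def openBox (a b c d : ℝ) : Set Plane := {p | a < p 0 ∧ p 0 < b ∧ c < p 1 ∧ p 1 < d}

/-- The closed box `[a, b] × [c, d]`. -/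
def closedBox (a b c d : ℝ) : Set Plane := {p | a ≤ p 0 ∧ p 0 ≤ b ∧ c ≤ p 1 ∧ p 1 ≤ d}

lemma isOpen_openBox (a b c d : ℝ) : IsOpen (openBox a b c d) := by
  have h0 := continuous_coord 0
  have h1 := continuous_coord 1
  exact (isOpen_lt continuous_const h0).inter <| (isOpen_lt h0 continuous_const).inter <|
    (isOpen_lt continuous_const h1).inter (isOpen_lt h1 continuous_const)

lemma isClosed_closedBox (a b c d : ℝ) : IsClosed (closedBox a b c d) := by
  have h0 := continuous_coord 0
  have h1 := continuous_coord 1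
  exact (isClosed_le continuous_const h0).inter <| (isClosed_le h0 continuous_const).inter <|
    (isClosed_le continuous_const h1).inter (isClosed_le h1 continuous_const)

lemma closedBox_eq_preimage (a b c d : ℝ) : closedBox a b c d =
    (MeasurableEquiv.toLp 2 (Fin 2 → ℝ)).symm ⁻¹' Icc ![a, c] ![b, d] := by
  ext p
  simp [closedBox, Pi.le_def, Fin.forall_fin_two]
  tauto

lemma openBox_eq_preimage (a b c d : ℝ) : openBox a b c d =
    (MeasurableEquiv.toLp 2 (Fin 2 → ℝ)).symm ⁻¹'
      (univ.pi fun i => Ioo ((![a, c] : Fin 2 → ℝ) i) ((![b, d] : Fin 2 → ℝ) i)) := by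
  ext p
  simp [openBox, Fin.forall_fin_two]
  tauto

lemma volume_closedBox (a b c d : ℝ) :
    volume (closedBox a b c d) = ENNReal.ofReal (b - a) * ENNReal.ofReal (d - c) := by
  rw [closedBox_eq_preimage,
    (EuclideanSpace.volume_preserving_symm_measurableEquiv_toLp (Fin 2)).measure_preimage_equiv,
    Real.volume_Icc_pi]
  simp [Fin.prod_univ_two]

lemma volume_openBox (a b c d : ℝ) :
    volume (openBox a b c d) = ENNReal.ofReal (b - a) * ENNReal.ofReal (d - c) := by
  rw [openBox_eq_preimage,
    (EuclideanSpace.volume_preserving_symm_measurableEquiv_toLp (Fin 2)).measure_preimage_equiv,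
    Real.volume_pi_Ioo]
  simp [Fin.prod_univ_two]

lemma isCompact_closedBox (a b c d : ℝ) : IsCompact (closedBox a b c d) := by
  rw [closedBox_eq_preimage]
  exact ((PiLp.homeomorph 2 (fun _ : Fin 2 => ℝ)).isCompact_preimage).2 isCompact_Icc

lemma openBox_subset_closedBox (a b c d : ℝ) : openBox a b c d ⊆ closedBox a b c d :=
  fun _ h => ⟨h.1.le, h.2.1.le, h.2.2.1.le, h.2.2.2.le⟩

lemma closure_openBox {a b c d : ℝ} (hab : a < b) (hcd : c < d) :
    closure (openBox a b c d) = closedBox a b c d := by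
  refine subset_antisymm
    (closure_minimal (openBox_subset_closedBox a b c d) (isClosed_closedBox a b c d)) ?_
  intro p hp
  have hq : pt ((a + b) / 2) ((c + d) / 2) ∈ openBox a b c d := by
    refine ⟨?_, ?_, ?_, ?_⟩ <;> simp <;> linarith
  have hc : Filter.Tendsto (fun t : ℝ => p + t • (pt ((a + b) / 2) ((c + d) / 2) - p))
      (nhdsWithin 0 (Ioi 0)) (nhds p) := by
    have : Continuous fun t : ℝ => p + t • (pt ((a + b) / 2) ((c + d) / 2) - p) := by fun_prop
    have := this.tendsto 0
    simp only [zero_smul, add_zero] at this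
    exact this.mono_left nhdsWithin_le_nhds
  refine mem_closure_of_tendsto hc ?_
  filter_upwards [Ioo_mem_nhdsGT (show (0 : ℝ) < 1 by norm_num)] with t ht
  obtain ⟨h1, h2, h3, h4⟩ := hp
  have := ht.1
  have := ht.2
  refine ⟨?_, ?_, ?_, ?_⟩ <;> simp <;> nlinarith

lemma mem_interior_half {α β γ : ℝ} (h : α ≠ 0 ∨ β ≠ 0) {S : Set Plane}
    (hS : ∀ p ∈ S, 0 ≤ α * p 0 + β * p 1 + γ) {p : Plane} (hp : p ∈ interior S) :
    0 < α * p 0 + β * p 1 + γ := by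
  have hc : Continuous fun t : ℝ => p - t • pt α β := by fun_prop
  have h0 : ∀ᶠ t in nhds (0 : ℝ), p - t • pt α β ∈ interior S :=
    hc.continuousAt.eventually_mem (by simpa using isOpen_interior.mem_nhds hp)
  obtain ⟨t, ht, ht0⟩ := ((h0.filter_mono nhdsWithin_le_nhds).and
    (self_mem_nhdsWithin : Ioi (0 : ℝ) ∈ nhdsWithin 0 (Ioi 0))).exists
  have := hS _ (interior_subset ht)
  simp only [PiLp.sub_apply, PiLp.smul_apply, pt_zero, pt_one, smul_eq_mul] at this
  have hpos : 0 < α ^ 2 + β ^ 2 := by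
    rcases h with h | h <;> positivity
  have : 0 < t * (α ^ 2 + β ^ 2) := mul_pos ht0 hpos
  nlinarith

lemma interior_closedBox_subset (a b c d : ℝ) :
    interior (closedBox a b c d) ⊆ openBox a b c d := by
  intro p hp
  have h1 := mem_interior_half (α := 1) (β := 0) (γ := -a) (by simp)
    (fun p hp => by linarith [hp.1]) hp
  have h2 := mem_interior_half (α := -1) (β := 0) (γ := b) (by simp)
    (fun p hp => by linarith [hp.2.1]) hp
  have h3 := mem_interior_half (α := 0) (β := 1) (γ := -c) (by simp)
    (fun p hp => by linarith [hp.2.2.1]) hp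
  have h4 := mem_interior_half (α := 0) (β := -1) (γ := d) (by simp)
    (fun p hp => by linarith [hp.2.2.2]) hp
  exact ⟨by linarith, by linarith, by linarith, by linarith⟩

/-- Twice the signed area of the triangle `a b p`. -/
def cross (a b p : Plane) : ℝ := (b 0 - a 0) * (p 1 - a 1) - (b 1 - a 1) * (p 0 - a 0)

lemma mem_triangle_iff {a b c : Plane} (h : 0 < cross a b c) (p : Plane) :
    p ∈ convexHull ℝ {a, b, c} ↔ 0 ≤ cross a b p ∧ 0 ≤ cross b c p ∧ 0 ≤ cross c a p := by
  constructor
  · intro hp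
    have key : ∀ u v : Plane, Convex ℝ {p : Plane | 0 ≤ cross u v p} := by
      intro u v x hx y hy s t hs ht hst
      simp only [cross, mem_ofPred_eq, PiLp.add_apply, PiLp.smul_apply, smul_eq_mul] at *
      obtain rfl : t = 1 - s := by linarith
      nlinarith
    have hsub : convexHull ℝ {a, b, c} ⊆ {p : Plane | 0 ≤ cross a b p} ∩
        ({p : Plane | 0 ≤ cross b c p} ∩ {p : Plane | 0 ≤ cross c a p}) := by
      refine convexHull_min ?_ ((key _ _).inter ((key _ _).inter (key _ _)))
      rintro q (rfl | rfl | rfl) <;> simp only [mem_inter_iff, mem_ofPred_eq] <;>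
        refine ⟨?_, ?_, ?_⟩ <;> simp only [cross] at * <;> linarith
    exact hsub hp
  · rintro ⟨h1, h2, h3⟩
    set D := cross a b c
    have hsum : cross b c p + cross c a p + cross a b p = D := by
      simp only [cross, D]; ring
    have : p = ∑ i, (![cross b c p / D, cross c a p / D, cross a b p / D] : Fin 3 → ℝ) i •
        (![a, b, c] : Fin 3 → Plane) i := by
      apply plane_ext <;>
      · simp [Fin.sum_univ_three]
        field_simp
        simp only [D, cross]; ring
    rw [this]
    apply (convex_convexHull ℝ _).sum_mem
    · intro i _
      fin_cases i <;> simp <;> positivity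
    · simp only [Fin.sum_univ_three, Matrix.cons_val]
      rw [← add_div, ← add_div, hsum, div_self h.ne']
    · intro i _
      apply subset_convexHull
      fin_cases i <;> simp

lemma interior_triangle_subset {a b c : Plane} (h : 0 < cross a b c) {p : Plane}
    (hp : p ∈ interior (convexHull ℝ {a, b, c})) :
    0 < cross a b p ∧ 0 < cross b c p ∧ 0 < cross c a p := by
  have key : ∀ u v : Plane, (v 1 - u 1 ≠ 0 ∨ v 0 - u 0 ≠ 0) →
      (∀ q ∈ convexHull ℝ {a, b, c}, 0 ≤ cross u v q) → 0 < cross u v p := by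
    intro u v huv hq
    have := mem_interior_half (α := -(v 1 - u 1)) (β := v 0 - u 0)
      (γ := (v 1 - u 1) * u 0 - (v 0 - u 0) * u 1) (by simpa only [neg_ne_zero] using huv)
      (fun q hqq => by have := hq q hqq; simp only [cross] at this; linarith) hp
    simp only [cross]; linarith
  refine ⟨key _ _ ?_ fun q hq => ((mem_triangle_iff h q).1 hq).1,
    key _ _ ?_ fun q hq => ((mem_triangle_iff h q).1 hq).2.1,
    key _ _ ?_ fun q hq => ((mem_triangle_iff h q).1 hq).2.2⟩ <;>
  · by_contra hcon
    push Not at hcon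
    obtain ⟨h1, h2⟩ := hcon
    rw [sub_eq_zero] at h1 h2
    simp only [cross, h1, h2] at h
    linarith

/-- The six triangles into which the cell `[x₀, x₀ + l + r] × [y₀, y₀ + s]` is divided by the
points `(x₀ + l, y₀ + m)` and `(x₀ + l, y₀ + s - m)`. -/
def cellTriangle (x₀ y₀ l r m s : ℝ) : Fin 6 → Set Plane
  | 0 => convexHull ℝ {pt x₀ y₀, pt (x₀ + l + r) y₀, pt (x₀ + l) (y₀ + m)}
  | 1 => convexHull ℝ {pt (x₀ + l + r) (y₀ + s), pt x₀ (y₀ + s), pt (x₀ + l) (y₀ + s - m)}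
  | 2 => convexHull ℝ {pt x₀ y₀, pt (x₀ + l) (y₀ + m), pt x₀ (y₀ + s)}
  | 3 => convexHull ℝ {pt (x₀ + l) (y₀ + m), pt (x₀ + l) (y₀ + s - m), pt x₀ (y₀ + s)}
  | 4 => convexHull ℝ {pt (x₀ + l + r) y₀, pt (x₀ + l + r) (y₀ + s), pt (x₀ + l) (y₀ + m)}
  | 5 => convexHull ℝ {pt (x₀ + l) (y₀ + m), pt (x₀ + l + r) (y₀ + s), pt (x₀ + l) (y₀ + s - m)}

lemma isClosedTriangle_cellTriangle (x₀ y₀ l r m s : ℝ) (i : Fin 6) :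
    IsClosedTriangle (cellTriangle x₀ y₀ l r m s i) := by
  fin_cases i <;> exact ⟨_, _, _, rfl⟩

/-- The inequalities describing the triangles of a cell with corner at the origin. -/
def cellRegion (l r m s x y : ℝ) : Fin 6 → Prop
  | 0 => 0 ≤ y ∧ l * y ≤ m * x ∧ r * y ≤ m * (l + r - x)
  | 1 => y ≤ s ∧ l * (s - y) ≤ m * x ∧ r * (s - y) ≤ m * (l + r - x)
  | 2 => 0 ≤ x ∧ m * x ≤ l * y ∧ (s - m) * x ≤ l * (s - y)
  | 3 => x ≤ l ∧ m * x ≤ l * (s - y) ∧ l * (s - y) ≤ (s - m) * x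
  | 4 => x ≤ l + r ∧ m * (l + r - x) ≤ r * y ∧ (s - m) * (l + r - x) ≤ r * (s - y)
  | 5 => l ≤ x ∧ m * (l + r - x) ≤ r * (s - y) ∧ r * (s - y) ≤ (s - m) * (l + r - x)

/-- The strict inequalities describing the interiors of the triangles of a cell. -/
def cellInterior (l r m s x y : ℝ) : Fin 6 → Prop
  | 0 => 0 < y ∧ l * y < m * x ∧ r * y < m * (l + r - x)
  | 1 => y < s ∧ l * (s - y) < m * x ∧ r * (s - y) < m * (l + r - x)
  | 2 => 0 < x ∧ m * x < l * y ∧ (s - m) * x < l * (s - y)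
  | 3 => x < l ∧ m * x < l * (s - y) ∧ l * (s - y) < (s - m) * x
  | 4 => x < l + r ∧ m * (l + r - x) < r * y ∧ (s - m) * (l + r - x) < r * (s - y)
  | 5 => l < x ∧ m * (l + r - x) < r * (s - y) ∧ r * (s - y) < (s - m) * (l + r - x)

section Cell

variable {l r m s : ℝ}

lemma mem_cellTriangle_iff (hl : 0 < l) (hr : 0 < r) (hm : 0 < m) (hs : 2 * m < s)
    (x₀ y₀ : ℝ) (i : Fin 6) (q : Plane) :
    q ∈ cellTriangle x₀ y₀ l r m s i ↔ cellRegion l r m s (q 0 - x₀) (q 1 - y₀) i := by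
  have hs0 : 0 < s := by linarith
  have hsm : 0 < s - 2 * m := by linarith
  have hlr : 0 < l + r := by linarith
  have e1 := mul_pos hl hs0
  have e2 := mul_pos hr hs0
  have e3 := mul_pos hlr hm
  have e4 := mul_pos hl hsm
  have e5 := mul_pos hr hsm
  fin_cases i <;> simp only [cellTriangle, Fin.zero_eta, Fin.mk_one, Fin.reduceFinMk] <;>
    rw [mem_triangle_iff (by simp only [cross, pt_zero, pt_one]; linarith)] <;>
    simp only [cross, pt_zero, pt_one, cellRegion]
  · rw [show (x₀ + l + r - x₀) * (q 1 - y₀) - (y₀ - y₀) * (q 0 - x₀) = (l + r) * (q 1 - y₀) by ring,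
      mul_nonneg_iff_of_pos_left hlr]
    constructor <;> rintro ⟨h1, h2, h3⟩ <;> refine ⟨?_, ?_, ?_⟩ <;> linarith
  · rw [show (x₀ - (x₀ + l + r)) * (q 1 - (y₀ + s)) - (y₀ + s - (y₀ + s)) * (q 0 - (x₀ + l + r))
      = (l + r) * (s - (q 1 - y₀)) by ring, mul_nonneg_iff_of_pos_left hlr]
    constructor <;> rintro ⟨h1, h2, h3⟩ <;> refine ⟨?_, ?_, ?_⟩ <;> linarith
  · rw [show (x₀ - x₀) * (q 1 - (y₀ + s)) - (y₀ - (y₀ + s)) * (q 0 - x₀) = s * (q 0 - x₀) by ring,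
      mul_nonneg_iff_of_pos_left hs0]
    constructor <;> rintro ⟨h1, h2, h3⟩ <;> refine ⟨?_, ?_, ?_⟩ <;> linarith
  · rw [show (x₀ + l - (x₀ + l)) * (q 1 - (y₀ + m)) - (y₀ + s - m - (y₀ + m)) * (q 0 - (x₀ + l))
      = (s - 2 * m) * (l - (q 0 - x₀)) by ring, mul_nonneg_iff_of_pos_left hsm]
    constructor <;> rintro ⟨h1, h2, h3⟩ <;> refine ⟨?_, ?_, ?_⟩ <;> linarith
  · rw [show (x₀ + l + r - (x₀ + l + r)) * (q 1 - y₀) - (y₀ + s - y₀) * (q 0 - (x₀ + l + r))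
      = s * (l + r - (q 0 - x₀)) by ring, mul_nonneg_iff_of_pos_left hs0]
    constructor <;> rintro ⟨h1, h2, h3⟩ <;> refine ⟨?_, ?_, ?_⟩ <;> linarith
  · rw [show (x₀ + l - (x₀ + l)) * (q 1 - (y₀ + s - m)) -
      (y₀ + m - (y₀ + s - m)) * (q 0 - (x₀ + l))
      = (s - 2 * m) * (q 0 - x₀ - l) by ring, mul_nonneg_iff_of_pos_left hsm]
    constructor <;> rintro ⟨h1, h2, h3⟩ <;> refine ⟨?_, ?_, ?_⟩ <;> linarith

lemma cellInterior_of_mem_interior (hl : 0 < l) (hr : 0 < r) (hm : 0 < m) (hs : 2 * m < s)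
    {x₀ y₀ : ℝ} {i : Fin 6} {q : Plane} (hq : q ∈ interior (cellTriangle x₀ y₀ l r m s i)) :
    cellInterior l r m s (q 0 - x₀) (q 1 - y₀) i := by
  have hs0 : 0 < s := by linarith
  have hsm : 0 < s - 2 * m := by linarith
  have hlr : 0 < l + r := by linarith
  have e1 := mul_pos hl hs0
  have e2 := mul_pos hr hs0
  have e3 := mul_pos hlr hm
  have e4 := mul_pos hl hsm
  have e5 := mul_pos hr hsm
  fin_cases i <;>
    simp only [cellTriangle] at hq <;>
    replace hq := interior_triangle_subset (by simp only [cross, pt_zero, pt_one]; linarith) hq <;>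
    simp only [cross, pt_zero, pt_one] at hq <;>
    simp only [cellInterior] <;>
    obtain ⟨h1, h2, h3⟩ := hq
  · exact ⟨pos_of_mul_pos_right (a := l + r) (by linarith) hlr.le, by linarith, by linarith⟩
  · exact ⟨sub_pos.1 <| pos_of_mul_pos_right (a := l + r) (by linarith) hlr.le,
      by linarith, by linarith⟩
  · exact ⟨pos_of_mul_pos_right (a := s) (by linarith) hs0.le, by linarith, by linarith⟩
  · exact ⟨sub_pos.1 <| pos_of_mul_pos_right (a := s - 2 * m) (by linarith) hsm.le,
      by linarith, by linarith⟩
  · exact ⟨sub_pos.1 <| pos_of_mul_pos_right (a := s) (by linarith) hs0.le,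
      by linarith, by linarith⟩
  · exact ⟨sub_pos.1 <| pos_of_mul_pos_right (a := s - 2 * m) (by linarith) hsm.le,
      by linarith, by linarith⟩

lemma cellRegion_box (hl : 0 < l) (hr : 0 < r) (hm : 0 < m) (hs : 2 * m < s) {x y : ℝ}
    {i : Fin 6} (h : cellRegion l r m s x y i) :
    (0 ≤ x ∧ x ≤ l + r) ∧ 0 ≤ y ∧ y ≤ s := by
  fin_cases i <;> simp only [cellRegion] at h <;>
    obtain ⟨h1, h2, h3⟩ := h <;> refine ⟨⟨?_, ?_⟩, ?_, ?_⟩ <;> by_contra! hc <;> first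
      | nlinarith
      | (have : 0 ≤ x := by by_contra! h; nlinarith
         nlinarith)
      | (have : 0 ≤ l + r - x := by by_contra! h; nlinarith
         nlinarith)

lemma exists_cellRegion (hl : 0 < l) (hr : 0 < r) (hm : 0 < m) {x y : ℝ}
    (hx : 0 ≤ x) (hx' : x ≤ l + r) (hy : 0 ≤ y) (hy' : y ≤ s) :
    ∃ i, cellRegion l r m s x y i := by
  rcases le_total x l with hxl | hxl
  · rcases le_total (l * y) (m * x) with h | h
    · exact ⟨0, hy, h, by
        have : y ≤ m := by by_contra! hc; nlinarith
        nlinarith⟩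
    rcases le_total (l * (s - y)) (m * x) with h' | h'
    · exact ⟨1, hy', h', by
        have : s - y ≤ m := by by_contra! hc; nlinarith
        nlinarith⟩
    rcases le_total (l * (s - y)) ((s - m) * x) with h'' | h''
    · exact ⟨3, hxl, h', h''⟩
    · exact ⟨2, hx, h, h''⟩
  · rcases le_total (r * y) (m * (l + r - x)) with h | h
    · exact ⟨0, hy, by
        have : y ≤ m := by by_contra! hc; nlinarith
        nlinarith, h⟩
    rcases le_total (r * (s - y)) (m * (l + r - x)) with h' | h'
    · exact ⟨1, hy', by
        have : s - y ≤ m := by by_contra! hc; nlinarith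
        nlinarith, h'⟩
    rcases le_total (r * (s - y)) ((s - m) * (l + r - x)) with h'' | h''
    · exact ⟨5, hxl, h', h''⟩
    · exact ⟨4, hx', h, h''⟩

lemma cellInterior_left (hm : 0 < m) (hs : 2 * m < s) {x y : ℝ}
    (h : cellInterior l r m s x y 2 ∨ cellInterior l r m s x y 3) :
    0 < x ∧ x < l ∧ m * x < l * y ∧ m * x < l * (s - y) := by
  simp only [cellInterior] at h
  rcases h with ⟨h1, h2, h3⟩ | ⟨h1, h2, h3⟩ <;> refine ⟨?_, ?_, ?_, ?_⟩ <;> by_contra! hc <;>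
    nlinarith

lemma cellInterior_right (hm : 0 < m) (hs : 2 * m < s) {x y : ℝ}
    (h : cellInterior l r m s x y 4 ∨ cellInterior l r m s x y 5) :
    l < x ∧ m * (l + r - x) < r * y ∧ m * (l + r - x) < r * (s - y) := by
  simp only [cellInterior] at h
  rcases h with ⟨h1, h2, h3⟩ | ⟨h1, h2, h3⟩ <;> refine ⟨?_, ?_, ?_⟩ <;> by_contra! hc <;>
    nlinarith

lemma cellInterior_inj (hl : 0 < l) (hr : 0 < r) (hm : 0 < m) (hs : 2 * m < s) {x y : ℝ}
    {i j : Fin 6} (hi : cellInterior l r m s x y i) (hj : cellInterior l r m s x y j) : i = j := by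
  wlog hij : i < j generalizing i j
  · rcases lt_trichotomy i j with h | h | h
    · exact this hi hj h
    · exact h
    · exact (this hj hi h).symm
  exfalso
  have left := cellInterior_left (l := l) (r := r) (x := x) (y := y) hm hs
  have right := cellInterior_right (l := l) (r := r) (x := x) (y := y) hm hs
  have h01 : cellInterior l r m s x y 0 → ¬ cellInterior l r m s x y 1 := by
    rintro ⟨_, h1, h2⟩ ⟨_, h3, h4⟩
    nlinarith
  have h23 : cellInterior l r m s x y 2 → ¬ cellInterior l r m s x y 3 := by
    rintro ⟨_, h1, h2⟩ ⟨_, h3, h4⟩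
    linarith
  have h45 : cellInterior l r m s x y 4 → ¬ cellInterior l r m s x y 5 := by
    rintro ⟨_, h1, h2⟩ ⟨_, h3, h4⟩
    linarith
  have bot : cellInterior l r m s x y 0 → l * y < m * x ∧ r * y < m * (l + r - x) := fun h => h.2
  have top : cellInterior l r m s x y 1 →
    l * (s - y) < m * x ∧ r * (s - y) < m * (l + r - x) := fun h => h.2
  fin_cases i <;> fin_cases j <;> first
    | (exfalso; revert hij; decide)
    | (simp only [Fin.zero_eta, Fin.mk_one, Fin.reduceFinMk] at hi hj
       first
       | exact h01 hi hj
       | exact h23 hi hj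
       | exact h45 hi hj
       | (have := bot hi; have := left (.inl hj); linarith)
       | (have := bot hi; have := left (.inr hj); linarith)
       | (have := bot hi; have := right (.inl hj); linarith)
       | (have := bot hi; have := right (.inr hj); linarith)
       | (have := top hi; have := left (.inl hj); linarith)
       | (have := top hi; have := left (.inr hj); linarith)
       | (have := top hi; have := right (.inl hj); linarith)
       | (have := top hi; have := right (.inr hj); linarith)
       | (have := left (.inl hi); have := right (.inl hj); linarith)
       | (have := left (.inl hi); have := right (.inr hj); linarith)
       | (have := left (.inr hi); have := right (.inl hj); linarith)
       | (have := left (.inr hi); have := right (.inr hj); linarith))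

end Cell

/-- The `k`-th tooth: a tent function vanishing at `a + k L` and `a + (k + 1) L`, with slopes
`α` and `-β`. -/
def tooth (α β L a : ℝ) (k : ℕ) (x : ℝ) : ℝ :=
  min (α * (x - (a + k * L))) (β * (a + (k + 1) * L - x))

/-- The sawtooth function with `N` teeth on `[a, a + N L]`, zero elsewhere. -/
def sawtooth (α β L a : ℝ) : ℕ → ℝ → ℝ
  | 0, _ => 0
  | k + 1, x => max (sawtooth α β L a k x) (tooth α β L a k x)

section Sawtooth

variable {α β L a : ℝ}

lemma sawtooth_nonneg (N : ℕ) (x : ℝ) : 0 ≤ sawtooth α β L a N x := by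
  induction N with
  | zero => exact le_rfl
  | succ k ih => exact le_max_of_le_left ih

lemma sawtooth_le (hα : 0 < α) (hβ : 0 < β) (hL : 0 ≤ L) {m : ℝ} (hm : (α + β) * m = α * β * L)
    (N : ℕ) (x : ℝ) : sawtooth α β L a N x ≤ m := by
  have hm0 : 0 ≤ m := by
    by_contra! h
    have := mul_nonneg (mul_pos hα hβ).le hL
    nlinarith
  induction N with
  | zero => exact hm0
  | succ k ih =>
    refine max_le ih ?_
    have h1 := min_le_left (α * (x - (a + k * L))) (β * (a + (k + 1) * L - x))
    have h2 := min_le_right (α * (x - (a + k * L))) (β * (a + (k + 1) * L - x))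
    rw [tooth]
    set t := min (α * (x - (a + k * L))) (β * (a + (k + 1) * L - x))
    nlinarith

lemma lipschitzWith_tooth {C : ℝ≥0} (hα : 0 < α) (hβ : 0 < β) (hαC : α ≤ C) (hβC : β ≤ C)
    (k : ℕ) : LipschitzWith C (tooth α β L a k) := by
  rw [← max_self C]
  refine LipschitzWith.min ?_ ?_ <;> refine LipschitzWith.of_dist_le_mul fun x y => ?_ <;>
    rw [Real.dist_eq, Real.dist_eq]
  · rw [show α * (x - (a + k * L)) - α * (y - (a + k * L)) = α * (x - y) by ring, abs_mul,
      abs_of_pos hα]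
    gcongr
  · rw [show β * (a + (k + 1) * L - x) - β * (a + (k + 1) * L - y) = -(β * (x - y)) by ring,
      abs_neg, abs_mul, abs_of_pos hβ]
    gcongr

lemma lipschitzWith_sawtooth {C : ℝ≥0} (hα : 0 < α) (hβ : 0 < β) (hαC : α ≤ C) (hβC : β ≤ C)
    (N : ℕ) : LipschitzWith C (sawtooth α β L a N) := by
  induction N with
  | zero => exact (LipschitzWith.const (0 : ℝ)).weaken zero_le
  | succ k ih =>
    rw [← max_self C]
    exact ih.max (lipschitzWith_tooth hα hβ hαC hβC k)

lemma sawtooth_slope (hα : 0 < α) (hβ : 0 < β) (N : ℕ) {x x' : ℝ} (h : x ≤ x') :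
    sawtooth α β L a N x - β * (x' - x) ≤ sawtooth α β L a N x' := by
  have hpos := mul_nonneg hβ.le (sub_nonneg.2 h)
  induction N with
  | zero => simpa [sawtooth] using hpos
  | succ k ih =>
    simp only [sawtooth]
    rw [sub_le_iff_le_add]
    refine max_le ?_ ?_
    · linarith [le_max_left (sawtooth α β L a k x') (tooth α β L a k x')]
    · have hpos' := mul_nonneg hα.le (sub_nonneg.2 h)
      have : tooth α β L a k x - β * (x' - x) ≤ tooth α β L a k x' := by
        have h1 := min_le_left (α * (x - (a + k * L))) (β * (a + (k + 1) * L - x))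
        have h2 := min_le_right (α * (x - (a + k * L))) (β * (a + (k + 1) * L - x))
        refine le_min ?_ ?_ <;> rw [tooth] <;> linarith
      linarith [le_max_right (sawtooth α β L a k x') (tooth α β L a k x')]

lemma sawtooth_eq_zero (hα : 0 < α) (hβ : 0 < β) (hL : 0 ≤ L) {N : ℕ} {x : ℝ}
    (h : x ≤ a ∨ a + N * L ≤ x) : sawtooth α β L a N x = 0 := by
  induction N with
  | zero => rfl
  | succ k ih =>
    have hk : (0 : ℝ) ≤ k * L := by positivity
    push_cast at h
    have ih := ih (h.imp_right fun h => by linarith)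
    rw [sawtooth, ih]
    refine max_eq_left ?_
    rcases h with h | h
    · exact min_le_of_left_le (mul_nonpos_of_nonneg_of_nonpos hα.le (by linarith))
    · exact min_le_of_right_le (mul_nonpos_of_nonneg_of_nonpos hβ.le (by linarith))

lemma sawtooth_eq_tooth (hα : 0 < α) (hβ : 0 < β) (hL : 0 ≤ L) {N k : ℕ} (hk : k < N) {x : ℝ}
    (h : a + k * L ≤ x) (h' : x ≤ a + (k + 1) * L) :
    sawtooth α β L a N x = tooth α β L a k x := by
  have hpos : 0 ≤ tooth α β L a k x :=
    le_min (mul_nonneg hα.le (by linarith)) (mul_nonneg hβ.le (by linarith))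
  induction N with
  | zero => simp at hk
  | succ j ih =>
    rw [sawtooth]
    rcases Nat.lt_succ_iff_lt_or_eq.1 hk with hkj | rfl
    · rw [ih hkj]
      refine max_eq_left (le_trans (min_le_of_left_le ?_) hpos)
      have : ((k : ℝ) + 1) ≤ j := by exact_mod_cast hkj
      exact mul_nonpos_of_nonneg_of_nonpos hα.le (by nlinarith)
    · rw [sawtooth_eq_zero hα hβ hL (.inr h)]
      exact max_eq_right hpos

end Sawtooth

/-- The properties of a perturbation `u` of the first coordinate which keep the variation under
control: it is small, vanishes outside the square `[a, a + s] × [b, b + s]`, decreases with slope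
at most one in the horizontal direction, and depends only on the first coordinate at distance at
least `m` from the horizontal edges. -/
structure IsSmallBump (a b s m : ℝ) (C : ℝ≥0) (u : Plane → ℝ) : Prop where
  lip : LipschitzWith C u
  nonneg : ∀ p, 0 ≤ u p
  le : ∀ p, u p ≤ m
  zero : ∀ p ∉ closedBox a (a + s) b (b + s), u p = 0
  slope : ∀ p t, 0 ≤ t → u p - t ≤ u (p + t • e2 0)
  vert : ∀ p q : Plane, b + m < p 1 → p 1 < b + s - m → b + m < q 1 → q 1 < b + s - m →
    p 0 = q 0 → u p = u q

/-- The composition of the affine map `P` with `p ↦ p + u p • e₀`. -/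
def perturb (P : Plane →ᵃ[ℝ] Plane) (u : Plane → ℝ) (p : Plane) : Plane :=
  P p + u p • P.linear (e2 0)

lemma integral_mul_fderiv {f ψ : Plane → ℝ} {C : ℝ≥0} (hf : LipschitzWith C f)
    (hψ : ContDiff ℝ 1 ψ) (hc : HasCompactSupport ψ) (v : Plane) :
    ∫ x, f x * fderiv ℝ ψ x v = -∫ x, lineDeriv ℝ f x v * ψ x := by
  obtain ⟨D, hD⟩ := hψ.lipschitzWith_of_hasCompactSupport hc one_ne_zero
  rw [hf.integral_lineDeriv_mul_eq hD hc, ← integral_neg]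
  congr 1 with x
  rw [(hψ.differentiable one_ne_zero x).lineDeriv_eq_fderiv]
  simp [mul_comm]

lemma integrable_mul_fderiv {f ψ : Plane → ℝ} (hf : Continuous f)
    (hψ : ContDiff ℝ 1 ψ) (hc : HasCompactSupport ψ) (v : Plane) :
    Integrable fun x => f x * fderiv ℝ ψ x v := by
  have h1 : Continuous fun x => fderiv ℝ ψ x v :=
    (hψ.continuous_fderiv one_ne_zero).clm_apply continuous_const
  have h2 : HasCompactSupport fun x => fderiv ℝ ψ x v := hc.fderiv_apply (𝕜 := ℝ) v
  exact (hf.mul h1).integrable_of_hasCompactSupport h2.mul_left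

lemma affineMap_coord (P : Plane →ᵃ[ℝ] Plane) (i : Fin 2) :
    ∃ ℓ : Plane →L[ℝ] ℝ, (∀ x, P x i = ℓ x + P 0 i) ∧ ∀ v, ℓ v = P.linear v i := by
  refine ⟨(EuclideanSpace.proj i).comp (LinearMap.toContinuousLinearMap P.linear), fun x => ?_,
    fun v => rfl⟩
  have := congrFun P.decomp x
  simp only [Pi.add_apply] at this
  rw [this]
  rfl

lemma continuous_affineMap (P : Plane →ᵃ[ℝ] Plane) : Continuous P :=
  P.continuous_of_finiteDimensional

lemma integral_affine_mul_fderiv (P : Plane →ᵃ[ℝ] Plane) (i : Fin 2) {ψ : Plane → ℝ}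
    (hψ : ContDiff ℝ 1 ψ) (hc : HasCompactSupport ψ) (v : Plane) :
    ∫ x, P x i * fderiv ℝ ψ x v = -(P.linear v i * ∫ x, ψ x) := by
  obtain ⟨ℓ, h1, h2⟩ := affineMap_coord P i
  have hlip : LipschitzWith ‖ℓ‖₊ fun x => P x i := by
    refine LipschitzWith.of_dist_le_mul fun x y => ?_
    rw [h1 x, h1 y, dist_add_right]
    exact ℓ.lipschitz.dist_le_mul x y
  rw [integral_mul_fderiv hlip hψ hc, ← integral_const_mul]
  congr 2 with x
  have : HasFDerivAt (fun x => P x i) ℓ x := by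
    rw [funext h1]
    exact ℓ.hasFDerivAt.add_const _
  rw [(this.hasLineDerivAt v).lineDeriv, h2]

lemma perturb_apply (P : Plane →ᵃ[ℝ] Plane) (u : Plane → ℝ) (p : Plane) (i : Fin 2) :
    perturb P u p i = P p i + P.linear (e2 0) i * u p := by
  simp [perturb, mul_comm]

lemma continuous_perturb (P : Plane →ᵃ[ℝ] Plane) {u : Plane → ℝ} (hu : Continuous u) :
    Continuous (perturb P u) :=
  (continuous_affineMap P).add (hu.smul continuous_const)

lemma integral_perturb_mul_fderiv (P : Plane →ᵃ[ℝ] Plane) {u : Plane → ℝ} (hu : Continuous u)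
    (i : Fin 2) {ψ : Plane → ℝ} (hψ : ContDiff ℝ 1 ψ) (hc : HasCompactSupport ψ) (v : Plane) :
    ∫ x, perturb P u x i * fderiv ℝ ψ x v =
      -(P.linear v i * ∫ x, ψ x) + P.linear (e2 0) i * ∫ x, u x * fderiv ℝ ψ x v := by
  have hP : Continuous fun x => P x i := (continuous_coord i).comp (continuous_affineMap P)
  simp_rw [perturb_apply, add_mul, mul_assoc]
  rw [integral_add (integrable_mul_fderiv hP hψ hc v)
    ((integrable_mul_fderiv hu hψ hc v).const_mul _), integral_const_mul,
    integral_affine_mul_fderiv P i hψ hc]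

lemma setIntegral_divergence {f : Plane → Plane} (hf : Continuous f) {φ : Plane → Plane × Plane}
    (hφ : ContDiff ℝ 1 φ) (hc : HasCompactSupport φ) {U : Set Plane} (hU : tsupport φ ⊆ U) :
    ∫ x in U, ((f x 0) * (fderiv ℝ (fun y => (φ y).1 0) x (e2 0)
                    + fderiv ℝ (fun y => (φ y).1 1) x (e2 1))
        + (f x 1) * (fderiv ℝ (fun y => (φ y).2 0) x (e2 0)
                    + fderiv ℝ (fun y => (φ y).2 1) x (e2 1))) =
      (∫ x, f x 0 * fderiv ℝ (fun y => (φ y).1 0) x (e2 0)) +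
      (∫ x, f x 0 * fderiv ℝ (fun y => (φ y).1 1) x (e2 1)) +
      ((∫ x, f x 1 * fderiv ℝ (fun y => (φ y).2 0) x (e2 0)) +
      (∫ x, f x 1 * fderiv ℝ (fun y => (φ y).2 1) x (e2 1))) := by
  have hs : ∀ g : Plane × Plane → ℝ, g 0 = 0 → tsupport (fun y => g (φ y)) ⊆ tsupport φ :=
    fun g hg => tsupport_comp_subset hg φ
  have hz : ∀ g : Plane × Plane → ℝ, g 0 = 0 → ∀ x ∉ U, ∀ v,
      fderiv ℝ (fun y => g (φ y)) x v = 0 := by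
    intro g hg x hx v
    have : fderiv ℝ (fun y => g (φ y)) x = 0 := by
      by_contra h
      exact hx (hU (hs g hg (support_fderiv_subset ℝ h)))
    simp [this]
  rw [setIntegral_eq_integral_of_forall_compl_eq_zero]
  · have i1 : ∀ j k, Integrable fun x => f x k * fderiv ℝ (fun y => (φ y).1 j) x (e2 j) :=
      fun j k => integrable_mul_fderiv ((continuous_coord k).comp hf) (by fun_prop)
        (hc.comp_left (g := fun q : Plane × Plane => q.1 j) rfl) _
    have i2 : ∀ j k, Integrable fun x => f x k * fderiv ℝ (fun y => (φ y).2 j) x (e2 j) :=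
      fun j k => integrable_mul_fderiv ((continuous_coord k).comp hf) (by fun_prop)
        (hc.comp_left (g := fun q : Plane × Plane => q.2 j) rfl) _
    simp_rw [mul_add]
    exact (integral_add ((i1 0 0).add (i1 1 0)) ((i2 0 1).add (i2 1 1))).trans
      (congrArg₂ (· + ·) (integral_add (i1 0 0) (i1 1 0)) (integral_add (i2 0 1) (i2 1 1)))
  · intro x hx
    rw [hz (fun q => q.1 0) rfl x hx, hz (fun q => q.1 1) rfl x hx, hz (fun q => q.2 0) rfl x hx,
      hz (fun q => q.2 1) rfl x hx]
    simp

section Bounds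

variable {a b s m : ℝ} {C : ℝ≥0} {u : Plane → ℝ}

lemma IsSmallBump.lineDeriv_eq_zero (h : IsSmallBump a b s m C u) {p : Plane}
    (hp : p ∉ closedBox a (a + s) b (b + s)) (v : Plane) : lineDeriv ℝ u p v = 0 := by
  have : u =ᶠ[nhds p] fun _ => 0 := by
    filter_upwards [(isClosed_closedBox a (a + s) b (b + s)).isOpen_compl.mem_nhds hp] with q hq
    exact h.zero q hq
  rw [this.lineDeriv_eq]
  simp [lineDeriv]

lemma IsSmallBump.hasCompactSupport (h : IsSmallBump a b s m C u) : HasCompactSupport u :=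
  HasCompactSupport.intro (isCompact_closedBox a (a + s) b (b + s)) h.zero

lemma IsSmallBump.integrable_lineDeriv (h : IsSmallBump a b s m C u) (v : Plane) :
    Integrable (fun x => lineDeriv ℝ u x v) := by
  have := (h.lip.locallyIntegrable_lineDeriv (μ := volume) v).integrableOn_isCompact
    (isCompact_closedBox a (a + s) b (b + s))
  refine this.integrable_of_forall_notMem_eq_zero fun x hx => h.lineDeriv_eq_zero hx v

lemma IsSmallBump.integral_lineDeriv (h : IsSmallBump a b s m C u) (v : Plane) :
    ∫ x, lineDeriv ℝ u x v = 0 := by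
  have hconst : ∀ x, lineDeriv ℝ (fun _ : Plane => (1 : ℝ)) x (-v) = 0 := by simp [lineDeriv]
  have := (LipschitzWith.const (α := Plane) (1 : ℝ)).integral_lineDeriv_mul_eq (μ := volume)
    h.lip h.hasCompactSupport (-v)
  simpa [hconst] using this.symm

lemma IsSmallBump.one_add_lineDeriv_nonneg (h : IsSmallBump a b s m C u) (p : Plane) :
    0 ≤ 1 + lineDeriv ℝ u p (e2 0) := by
  by_cases hd : LineDifferentiableAt ℝ u p (e2 0)
  · have hmono : Monotone fun t : ℝ => t + u (p + t • e2 0) := by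
      intro t t' htt
      have := h.slope (p + t • e2 0) (t' - t) (by linarith)
      rw [add_assoc, ← add_smul, add_sub_cancel] at this
      simp only
      linarith
    have hder : HasDerivAt (fun t : ℝ => t + u (p + t • e2 0)) (1 + lineDeriv ℝ u p (e2 0)) 0 :=
      (hasDerivAt_id 0).add hd.hasLineDerivAt
    rw [← hder.deriv]
    exact hmono.deriv_nonneg
  · rw [lineDeriv_zero_of_not_lineDifferentiableAt hd]
    norm_num

lemma volume_real_closedBox_square (hs : 0 ≤ s) :
    volume.real (closedBox a (a + s) b (b + s)) = s ^ 2 := by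
  rw [measureReal_def, volume_closedBox, ENNReal.toReal_mul, ENNReal.toReal_ofReal (by linarith),
    ENNReal.toReal_ofReal (by linarith)]
  ring

lemma abs_integral_le_sq (hs : 0 ≤ s) {ψ : Plane → ℝ}
    (hb : ∀ x, |ψ x| ≤ 1) (hz : ∀ x ∉ closedBox a (a + s) b (b + s), ψ x = 0) :
    |∫ x, ψ x| ≤ s ^ 2 := by
  rw [← setIntegral_eq_integral_of_forall_compl_eq_zero hz, ← volume_real_closedBox_square hs,
    ← one_mul (volume.real _)]
  exact norm_setIntegral_le_of_norm_le_const (f := ψ) (C := 1)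
    (isCompact_closedBox a (a + s) b (b + s)).measure_lt_top (fun x _ => hb x)

lemma IsSmallBump.abs_integral_zero_le (h : IsSmallBump a b s m C u) (hs : 0 ≤ s) {ψ : Plane → ℝ}
    (hc : Continuous ψ) (hb : ∀ x, |ψ x| ≤ 1)
    (hz : ∀ x ∉ closedBox a (a + s) b (b + s), ψ x = 0) :
    |(∫ x, ψ x) + ∫ x, lineDeriv ℝ u x (e2 0) * ψ x| ≤ s ^ 2 := by
  set K := closedBox a (a + s) b (b + s)
  have hK : IsCompact K := isCompact_closedBox _ _ _ _
  have hψ : Integrable ψ := hc.integrable_of_hasCompactSupport (HasCompactSupport.intro hK hz)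
  have hD := h.integrable_lineDeriv (e2 0)
  have hDψ : Integrable fun x => lineDeriv ℝ u x (e2 0) * ψ x :=
    hD.mul_bdd (c := 1) hc.aestronglyMeasurable (.of_forall fun x => by simpa using hb x)
  rw [← integral_add hψ hDψ]
  have hz' : ∀ x ∉ K, ψ x + lineDeriv ℝ u x (e2 0) * ψ x = 0 := fun x hx => by simp [hz x hx]
  rw [← setIntegral_eq_integral_of_forall_compl_eq_zero hz']
  have hone : IntegrableOn (fun _ : Plane => (1 : ℝ)) K :=
    integrableOn_const hK.measure_lt_top.ne
  calc _ ≤ ∫ x in K, (1 + lineDeriv ℝ u x (e2 0)) := by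
        refine norm_integral_le_of_norm_le
          (f := fun x => ψ x + lineDeriv ℝ u x (e2 0) * ψ x) (hone.add hD.integrableOn)
          (.of_forall fun x => ?_)
        rw [show ψ x + lineDeriv ℝ u x (e2 0) * ψ x = (1 + lineDeriv ℝ u x (e2 0)) * ψ x by ring,
          norm_mul, Real.norm_of_nonneg (h.one_add_lineDeriv_nonneg x)]
        exact mul_le_of_le_one_right (h.one_add_lineDeriv_nonneg x) (hb x)
    _ = s ^ 2 := by
        rw [integral_add hone hD.integrableOn,
          setIntegral_eq_integral_of_forall_compl_eq_zero (f := fun x => lineDeriv ℝ u x (e2 0))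
            fun x hx => h.lineDeriv_eq_zero hx _, h.integral_lineDeriv]
        simp only [integral_const, smul_eq_mul, mul_one, add_zero]
        rw [measureReal_restrict_apply_univ]
        exact volume_real_closedBox_square hs

lemma IsSmallBump.abs_integral_one_le (h : IsSmallBump a b s m C u) (hs : 0 ≤ s) (hm : 0 ≤ m)
    {ψ : Plane → ℝ} (hb : ∀ x, |ψ x| ≤ 1) :
    |∫ x, lineDeriv ℝ u x (e2 1) * ψ x| ≤ C * (2 * m * s) := by
  set S := closedBox a (a + s) b (b + m) ∪ closedBox a (a + s) (b + s - m) (b + s)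
  have hS : volume S ≤ ENNReal.ofReal (2 * m * s) := by
    refine (measure_union_le _ _).trans ?_
    rw [volume_closedBox, volume_closedBox, ← ENNReal.ofReal_mul (by linarith),
      ← ENNReal.ofReal_mul (by linarith), ← ENNReal.ofReal_add (by ring_nf; positivity)
      (by ring_nf; positivity)]
    exact ENNReal.ofReal_le_ofReal (by linarith)
  have hz : ∀ x ∉ S, lineDeriv ℝ u x (e2 1) * ψ x = 0 := by
    intro x hx
    by_cases hK : x ∈ closedBox a (a + s) b (b + s)
    · have h1 : b + m < x 1 := by
        by_contra! hcon
        exact hx (.inl ⟨hK.1, hK.2.1, hK.2.2.1, hcon⟩)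
      have h2 : x 1 < b + s - m := by
        by_contra! hcon
        exact hx (.inr ⟨hK.1, hK.2.1, hcon, hK.2.2.2⟩)
      have hev : ∀ᶠ t : ℝ in nhds 0, u (x + t • e2 1) = u x := by
        have hc : Continuous fun t : ℝ => x 1 + t := by fun_prop
        have := hc.continuousAt.eventually_mem
          (show Ioo (b + m) (b + s - m) ∈ nhds (x 1 + 0) from
            isOpen_Ioo.mem_nhds (by simpa using ⟨h1, h2⟩))
        filter_upwards [this] with t ht
        exact h.vert _ _ (by simpa using ht.1) (by simpa using ht.2) h1 h2 (by simp)
      have : lineDeriv ℝ u x (e2 1) = 0 := by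
        rw [lineDeriv, Filter.EventuallyEq.deriv_eq (f := fun _ => u x) hev]
        simp
      rw [this, zero_mul]
    · rw [h.lineDeriv_eq_zero hK, zero_mul]
  rw [← setIntegral_eq_integral_of_forall_compl_eq_zero hz]
  refine (norm_setIntegral_le_of_norm_le_const (f := fun x => lineDeriv ℝ u x (e2 1) * ψ x)
    (C := C) (hS.trans_lt ENNReal.ofReal_lt_top)
    fun x _ => ?_).trans ?_
  · rw [norm_mul]
    have : ‖lineDeriv ℝ u x (e2 1)‖ ≤ C * ‖e2 1‖ := norm_lineDeriv_le_of_lipschitz ℝ h.lip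
    rw [norm_e2, mul_one] at this
    exact (mul_le_of_le_one_right (norm_nonneg _) (hb x)).trans this
  · gcongr
    exact ENNReal.toReal_le_of_le_ofReal (by positivity) hS

/-- The sum of the absolute values of the entries of the linear part of `P`. -/
def entrySum (P : Plane →ᵃ[ℝ] Plane) : ℝ :=
  |P.linear (e2 0) 0| + |P.linear (e2 1) 0| + (|P.linear (e2 0) 1| + |P.linear (e2 1) 1|)

/-- The sum of the absolute values of the entries of the first column. -/
def columnSum (P : Plane →ᵃ[ℝ] Plane) : ℝ := |P.linear (e2 0) 0| + |P.linear (e2 0) 1|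

lemma columnSum_nonneg (P : Plane →ᵃ[ℝ] Plane) : 0 ≤ columnSum P :=
  add_nonneg (abs_nonneg _) (abs_nonneg _)

lemma IsSmallBump.le_of_mem_varSet (h : IsSmallBump a b s m C u) (hs : 0 ≤ s) (hm : 0 ≤ m)
    (P : Plane →ᵃ[ℝ] Plane) {v : ℝ}
    (hv : v ∈ varSet (perturb P u) (openBox a (a + s) b (b + s))) :
    v ≤ entrySum P * s ^ 2 + columnSum P * (C * (2 * m * s)) := by
  obtain ⟨φ, hφ, hc, hU, hb, rfl⟩ := hv
  rw [setIntegral_divergence (continuous_perturb P h.lip.continuous) hφ hc hU]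
  have hz : ∀ x ∉ closedBox a (a + s) b (b + s), φ x = 0 := fun x hx =>
    image_eq_zero_of_notMem_tsupport fun hx' => hx (openBox_subset_closedBox _ _ _ _ (hU hx'))
  have key0 : ∀ i (ψ : Plane → ℝ), ContDiff ℝ 1 ψ → HasCompactSupport ψ → (∀ x, |ψ x| ≤ 1) →
      (∀ x ∉ closedBox a (a + s) b (b + s), ψ x = 0) →
      ∫ x, perturb P u x i * fderiv ℝ ψ x (e2 0) ≤ |P.linear (e2 0) i| * s ^ 2 := by
    intro i ψ hψ hψc hψb hψz
    rw [integral_perturb_mul_fderiv P h.lip.continuous i hψ hψc, integral_mul_fderiv h.lip hψ hψc]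
    refine (le_abs_self _).trans ?_
    rw [show -(P.linear (e2 0) i * ∫ x, ψ x) +
        P.linear (e2 0) i * -∫ x, lineDeriv ℝ u x (e2 0) * ψ x =
        -(P.linear (e2 0) i * ((∫ x, ψ x) + ∫ x, lineDeriv ℝ u x (e2 0) * ψ x)) by ring,
      abs_neg, abs_mul]
    gcongr
    exact h.abs_integral_zero_le hs hψ.continuous hψb hψz
  have key1 : ∀ i (ψ : Plane → ℝ), ContDiff ℝ 1 ψ → HasCompactSupport ψ → (∀ x, |ψ x| ≤ 1) →
      (∀ x ∉ closedBox a (a + s) b (b + s), ψ x = 0) →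
      ∫ x, perturb P u x i * fderiv ℝ ψ x (e2 1) ≤ |P.linear (e2 1) i| * s ^ 2 +
        |P.linear (e2 0) i| * (C * (2 * m * s)) := by
    intro i ψ hψ hψc hψb hψz
    rw [integral_perturb_mul_fderiv P h.lip.continuous i hψ hψc, integral_mul_fderiv h.lip hψ hψc]
    refine (le_abs_self _).trans ((abs_add_le _ _).trans ?_)
    rw [abs_neg, abs_mul, abs_mul, abs_neg]
    gcongr
    · exact abs_integral_le_sq hs hψb hψz
    · exact h.abs_integral_one_le hs hm hψb
  have k1 := key0 0 (fun y => (φ y).1 0) (by fun_prop)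
    (hc.comp_left (g := fun q : Plane × Plane => q.1 0) rfl)
    (fun x => (hb x 0).1) (fun x hx => by simp [hz x hx])
  have k2 := key1 0 (fun y => (φ y).1 1) (by fun_prop)
    (hc.comp_left (g := fun q : Plane × Plane => q.1 1) rfl)
    (fun x => (hb x 1).1) (fun x hx => by simp [hz x hx])
  have k3 := key0 1 (fun y => (φ y).2 0) (by fun_prop)
    (hc.comp_left (g := fun q : Plane × Plane => q.2 0) rfl)
    (fun x => (hb x 0).2) (fun x hx => by simp [hz x hx])
  have k4 := key1 1 (fun y => (φ y).2 1) (by fun_prop)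
    (hc.comp_left (g := fun q : Plane × Plane => q.2 1) rfl)
    (fun x => (hb x 1).2) (fun x hx => by simp [hz x hx])
  rw [entrySum, columnSum]
  linarith

end Bounds

lemma exists_cutoff (a b : ℝ) {s : ℝ} (hs : 0 < s) {η : ℝ} (hη : 0 < η) :
    ∃ χ : Plane → ℝ, ContDiff ℝ 1 χ ∧ HasCompactSupport χ ∧
      tsupport χ ⊆ openBox a (a + s) b (b + s) ∧ (∀ x, |χ x| ≤ 1) ∧ s ^ 2 - η ≤ ∫ x, χ x := by
  obtain ⟨t, ht0, hts, htη⟩ : ∃ t : ℝ, 0 < t ∧ 4 * t ≤ s ∧ 4 * s * t ≤ η := by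
    refine ⟨min (s / 4) (η / (4 * s)), by positivity, ?_, ?_⟩
    · linarith [min_le_left (s / 4) (η / (4 * s))]
    · have := min_le_right (s / 4) (η / (4 * s))
      rwa [le_div_iff₀ (by positivity), mul_comm] at this
  obtain ⟨χ, hd, hr, hsupp, hone⟩ := exists_contMDiff_support_eq_eq_one_iff
    (modelWithCornersSelf ℝ Plane) (n := 1)
    (isOpen_openBox (a + t / 2) (a + s - t / 2) (b + t / 2) (b + s - t / 2))
    (isClosed_closedBox (a + t) (a + s - t) (b + t) (b + s - t))
    (fun p hp => ⟨by linarith [hp.1], by linarith [hp.2.1], by linarith [hp.2.2.1],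
      by linarith [hp.2.2.2]⟩)
  have hχ : ContDiff ℝ 1 χ := contMDiff_iff_contDiff.1 hd
  have hts' : tsupport χ ⊆ closedBox (a + t / 2) (a + s - t / 2) (b + t / 2) (b + s - t / 2) := by
    rw [tsupport, hsupp]
    exact closure_minimal (openBox_subset_closedBox _ _ _ _) (isClosed_closedBox _ _ _ _)
  have hc : HasCompactSupport χ :=
    (isCompact_closedBox _ _ _ _).of_isClosed_subset (isClosed_tsupport χ) hts'
  have h01 : ∀ x, 0 ≤ χ x ∧ χ x ≤ 1 := fun x => hr (mem_range_self x)
  refine ⟨χ, hχ, hc, fun p hp => ?_, fun x => abs_le.2 ⟨by linarith [(h01 x).1], (h01 x).2⟩, ?_⟩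
  · obtain ⟨h1, h2, h3, h4⟩ := hts' hp
    exact ⟨by linarith, by linarith, by linarith, by linarith⟩
  · set K := closedBox (a + t) (a + s - t) (b + t) (b + s - t)
    have hint : Integrable χ := hχ.continuous.integrable_of_hasCompactSupport hc
    calc s ^ 2 - η ≤ (s - 2 * t) ^ 2 := by nlinarith
      _ = ∫ x in K, (1 : ℝ) := by
        rw [setIntegral_const, smul_eq_mul, mul_one, measureReal_def, volume_closedBox,
          ENNReal.toReal_mul, ENNReal.toReal_ofReal (by linarith),
          ENNReal.toReal_ofReal (by linarith)]
        ring
      _ = ∫ x in K, χ x :=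
        setIntegral_congr_fun (isClosed_closedBox _ _ _ _).measurableSet
          fun x hx => ((hone x).1 hx).symm
      _ ≤ ∫ x, χ x := setIntegral_le_integral hint (.of_forall fun x => (h01 x).1)

lemma exists_mem_varSet (P : Plane →ᵃ[ℝ] Plane) (a b : ℝ) {s : ℝ} (hs : 0 < s) {η : ℝ}
    (hη : 0 < η) : ∃ M : ℝ, 0 ≤ M ∧ ∀ (m : ℝ) (C : ℝ≥0) (u : Plane → ℝ),
      IsSmallBump a b s m C u → ∃ v ∈ varSet (perturb P u) (openBox a (a + s) b (b + s)),
        entrySum P * (s ^ 2 - η) - columnSum P * (m * M) ≤ v := by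
  obtain ⟨χ, hχ, hc, hU, hb, hint⟩ := exists_cutoff a b hs hη
  refine ⟨(∫ x, |fderiv ℝ χ x (e2 0)|) + ∫ x, |fderiv ℝ χ x (e2 1)|, by positivity, ?_⟩
  intro m C u h
  let σ (i j : Fin 2) : ℝ := -SignType.sign (P.linear (e2 j) i)
  have hσ : ∀ i j, |σ i j| ≤ 1 := by
    intro i j
    simp only [σ]
    rcases SignType.sign (P.linear (e2 j) i) with _ | _ | _ <;> simp
  have hbound : ∀ j, |∫ x, u x * fderiv ℝ χ x (e2 j)| ≤ m * ∫ x, |fderiv ℝ χ x (e2 j)| := by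
    intro j
    rw [← integral_const_mul]
    have hi := integrable_mul_fderiv (f := fun _ => 1) continuous_const hχ hc (e2 j)
    simp only [one_mul] at hi
    refine norm_integral_le_of_norm_le (f := fun x => u x * fderiv ℝ χ x (e2 j))
      (hi.abs.const_mul m) (.of_forall fun x => ?_)
    rw [norm_mul, Real.norm_of_nonneg (h.nonneg x), Real.norm_eq_abs]
    gcongr
    exact h.le x
  have key : ∀ i j, |P.linear (e2 j) i| * (s ^ 2 - η) -
      |P.linear (e2 0) i| * (m * ∫ x, |fderiv ℝ χ x (e2 j)|) ≤
      ∫ x, perturb P u x i * fderiv ℝ (fun y => σ i j * χ y) x (e2 j) := by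
    intro i j
    have : ∀ x, fderiv ℝ (fun y => σ i j * χ y) x (e2 j) = σ i j * fderiv ℝ χ x (e2 j) := by
      intro x
      rw [fderiv_const_mul (hχ.differentiable one_ne_zero x)]
      rfl
    simp_rw [this, mul_left_comm _ (σ i j)]
    rw [integral_const_mul, integral_perturb_mul_fderiv P h.lip.continuous i hχ hc]
    have hsign : σ i j * (P.linear (e2 j) i * ∫ x, χ x) =
        -(|P.linear (e2 j) i| * ∫ x, χ x) := by
      rw [← mul_assoc, ← neg_mul]
      simp only [σ, neg_mul, sign_mul_self]
    have hint' := mul_le_mul_of_nonneg_left hint (abs_nonneg (P.linear (e2 j) i))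
    have hsmall : |σ i j * (P.linear (e2 0) i * ∫ x, u x * fderiv ℝ χ x (e2 j))| ≤
        1 * (|P.linear (e2 0) i| * (m * ∫ x, |fderiv ℝ χ x (e2 j)|)) := by
      rw [abs_mul, abs_mul]
      gcongr
      · exact hσ i j
      · exact hbound j
    have hsmall' := (abs_le.1 hsmall).1
    rw [mul_add, mul_neg, hsign]
    linarith
  let φ : Plane → Plane × Plane := fun x =>
    (χ x • pt (σ 0 0) (σ 0 1), χ x • pt (σ 1 0) (σ 1 1))
  have hφ : ContDiff ℝ 1 φ := by fun_prop
  have hφ0 : Function.support φ ⊆ Function.support χ := by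
    intro x hx hx0
    exact hx (by simp [φ, hx0])
  have hφc : HasCompactSupport φ := hc.mono hφ0
  have hφU : tsupport φ ⊆ openBox a (a + s) b (b + s) := (closure_mono hφ0).trans hU
  refine ⟨_, ⟨φ, hφ, hφc, hφU, ?_, rfl⟩, ?_⟩
  · intro x i
    have : ∀ k l, |χ x| * |σ k l| ≤ 1 := fun k l =>
      mul_le_one₀ (hb x) (abs_nonneg _) (hσ k l)
    fin_cases i <;> simp [φ, abs_mul, this]
  · rw [setIntegral_divergence (continuous_perturb P h.lip.continuous) hφ hφc hφU]
    have k1 := key 0 0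
    have k2 := key 0 1
    have k3 := key 1 0
    have k4 := key 1 1
    simp only [φ, PiLp.smul_apply, pt_zero, pt_one, smul_eq_mul, mul_comm (χ _)]
    rw [entrySum, columnSum]
    linarith

lemma isSmallBump_zero (a b s : ℝ) : IsSmallBump a b s 0 0 (fun _ => 0) where
  lip := LipschitzWith.const 0
  nonneg _ := le_rfl
  le _ := le_rfl
  zero _ _ := rfl
  slope _ t ht := by simpa using ht
  vert _ _ _ _ _ _ _ := rfl

lemma perturb_zero (P : Plane →ᵃ[ℝ] Plane) : perturb P (fun _ => 0) = P := by
  ext1 p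
  simp [perturb]

lemma zero_mem_varSet (f : Plane → Plane) (U : Set Plane) : (0 : ℝ) ∈ varSet f U := by
  refine ⟨fun _ => 0, contDiff_const, HasCompactSupport.zero, ?_, by simp, by simp⟩
  rw [show (fun _ : Plane => (0 : Plane × Plane)) = 0 from rfl, tsupport_zero]
  exact empty_subset _

lemma entrySum_pos {P : Plane →ᵃ[ℝ] Plane} (hP : Function.Bijective P.linear) :
    0 < entrySum P := by
  by_contra! h
  rw [entrySum] at h
  have h1 := abs_nonneg (P.linear (e2 0) 0)
  have h2 := abs_nonneg (P.linear (e2 1) 0)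
  have h3 := abs_nonneg (P.linear (e2 0) 1)
  have h4 := abs_nonneg (P.linear (e2 1) 1)
  have : P.linear (e2 0) = P.linear 0 := by
    rw [map_zero]
    exact plane_ext (abs_eq_zero.1 (by linarith)) (abs_eq_zero.1 (by linarith))
  have := congrArg (fun p : Plane => p 0) (hP.1 this)
  simp at this

lemma Var_affine (P : Plane →ᵃ[ℝ] Plane) (a b : ℝ) {s : ℝ} (hs : 0 < s) :
    Var P (openBox a (a + s) b (b + s)) = entrySum P * s ^ 2 := by
  have hz := isSmallBump_zero a b s
  have hup : ∀ v ∈ varSet P (openBox a (a + s) b (b + s)), v ≤ entrySum P * s ^ 2 := by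
    intro v hv
    have := hz.le_of_mem_varSet hs.le le_rfl P (by rwa [perturb_zero])
    simpa using this
  have hE : 0 ≤ entrySum P := by unfold entrySum; positivity
  refine le_antisymm (csSup_le ⟨0, zero_mem_varSet _ _⟩ hup) ?_
  refine le_of_forall_pos_le_add fun ε hε => ?_
  obtain ⟨M, -, hM⟩ := exists_mem_varSet P a b hs (η := ε / (entrySum P + 1)) (by positivity)
  obtain ⟨v, hv, hle⟩ := hM 0 0 _ hz
  rw [perturb_zero] at hv
  have h1 : v ≤ Var P (openBox a (a + s) b (b + s)) := le_csSup ⟨_, hup⟩ hv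
  have h2 : entrySum P * (ε / (entrySum P + 1)) ≤ ε := by
    rw [mul_div_assoc', div_le_iff₀ (by positivity)]
    nlinarith
  simp only [zero_mul, mul_zero, sub_zero] at hle
  linarith

/-- A sufficiently small perturbation changes the variation of `P` only slightly. -/
lemma exists_abs_Var_perturb_sub_le {P : Plane →ᵃ[ℝ] Plane} (hP : Function.Bijective P.linear)
    (a b : ℝ) {s : ℝ} (hs : 0 < s) (C : ℝ≥0) {ε : ℝ} (hε : 0 < ε) :
    ∃ m₀ > 0, ∀ (m : ℝ) (u : Plane → ℝ), 0 ≤ m → m ≤ m₀ → IsSmallBump a b s m C u →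
      |Var (perturb P u) (openBox a (a + s) b (b + s)) - Var P (openBox a (a + s) b (b + s))| ≤
        ε * Var P (openBox a (a + s) b (b + s)) := by
  have hE := entrySum_pos hP
  have hcol := columnSum_nonneg P
  obtain ⟨M, hM0, hM⟩ := exists_mem_varSet P a b hs (η := ε * s ^ 2 / 2) (by positivity)
  rw [Var_affine P a b hs]
  set V := entrySum P * s ^ 2
  have hV : 0 < V := by positivity
  set B := columnSum P * (2 * C * s + M) + 1
  have hB : 0 < B := by positivity
  refine ⟨ε * V / 2 / B, by positivity, fun m u hm hmm h => ?_⟩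
  rw [le_div_iff₀ hB] at hmm
  have hup : ∀ v ∈ varSet (perturb P u) (openBox a (a + s) b (b + s)),
    v ≤ V + columnSum P * (C * (2 * m * s)) := fun v hv => h.le_of_mem_varSet hs.le hm P hv
  have h1 : Var (perturb P u) (openBox a (a + s) b (b + s)) ≤
      V + columnSum P * (C * (2 * m * s)) := csSup_le ⟨0, zero_mem_varSet _ _⟩ hup
  obtain ⟨v, hv, hle⟩ := hM m C u h
  have h2 : v ≤ Var (perturb P u) (openBox a (a + s) b (b + s)) := le_csSup ⟨_, hup⟩ hv
  have e1 : m * B = columnSum P * (C * (2 * m * s)) + columnSum P * (m * M) + m := by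
    simp only [B]; ring
  have e2 : 0 ≤ columnSum P * (C * (2 * m * s)) := by positivity
  have e3 : 0 ≤ columnSum P * (m * M) := by positivity
  have e4 : entrySum P * (s ^ 2 - ε * s ^ 2 / 2) = V - ε * V / 2 := by
    simp only [V]; ring
  have e5 : 0 < ε * V := by positivity
  rw [abs_le]
  constructor <;> linarith

/-- The bump which, on the square `[a, a + N L] × [b, b + s]`, is a sawtooth in the first variable
cut off linearly near the horizontal edges. -/
def bump (α β L a : ℝ) (N : ℕ) (b s : ℝ) (p : Plane) : ℝ :=
  min (sawtooth α β L a N (p 0)) (max 0 (min (p 1 - b) (b + s - p 1)))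

section Bump

variable {α β L a b s m : ℝ} {N : ℕ}

lemma bump_slope (hα : 0 < α) (hβ : 0 < β) (p : Plane) {t : ℝ} (ht : 0 ≤ t) :
    bump α β L a N b s p - β * t ≤ bump α β L a N b s (p + t • e2 0) := by
  have h := sawtooth_slope (L := L) (a := a) hα hβ N (le_add_of_nonneg_right ht : p 0 ≤ p 0 + t)
  have hβt := mul_nonneg hβ.le ht
  simp only [bump, PiLp.add_apply, PiLp.smul_apply, e2_zero_zero, e2_zero_one, smul_eq_mul,
    mul_one, mul_zero, add_zero]
  refine le_min ?_ ?_
  · linarith [min_le_left (sawtooth α β L a N (p 0)) (max 0 (min (p 1 - b) (b + s - p 1)))]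
  · linarith [min_le_right (sawtooth α β L a N (p 0)) (max 0 (min (p 1 - b) (b + s - p 1)))]

lemma bump_eq_zero (hα : 0 < α) (hβ : 0 < β) (hL : 0 ≤ L) (hN : N * L = s) {p : Plane}
    (hp : p ∉ openBox a (a + s) b (b + s)) : bump α β L a N b s p = 0 := by
  have h0 := sawtooth_nonneg (α := α) (β := β) (L := L) (a := a) N (p 0)
  by_cases hx : p 0 ≤ a ∨ a + N * L ≤ p 0
  · rw [bump, sawtooth_eq_zero hα hβ hL hx]
    exact min_eq_left (le_max_left _ _)
  · push Not at hx
    have : min (p 1 - b) (b + s - p 1) ≤ 0 := by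
      by_contra! h
      obtain ⟨h1, h2⟩ := lt_min_iff.1 h
      exact hp ⟨hx.1, by linarith, by linarith, by linarith⟩
    rw [bump, max_eq_left this]
    exact min_eq_right h0

lemma isSmallBump_bump {C : ℝ≥0} (hα : 0 < α) (hβ : 0 < β) (hβ1 : β ≤ 1) (hαC : α ≤ C)
    (hC : 1 ≤ C) (hL : 0 ≤ L) (hN : N * L = s) (hm : (α + β) * m = α * β * L) :
    IsSmallBump a b s m C (bump α β L a N b s) where
  lip := by
    have h0 : LipschitzWith 1 fun p : Plane => p 0 := LipschitzWith.of_dist_le_mul fun p q => by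
      simpa using PiLp.dist_apply_le p q 0
    have h1 : LipschitzWith 1 fun p : Plane => p 1 := LipschitzWith.of_dist_le_mul fun p q => by
      simpa using PiLp.dist_apply_le p q 1
    have hβC : β ≤ C := hβ1.trans (by exact_mod_cast hC)
    have hW := (lipschitzWith_sawtooth (L := L) (a := a) hα hβ hαC hβC N).comp h0
    have hd : LipschitzWith 1 fun p : Plane => min (p 1 - b) (b + s - p 1) := by
      have h2 := h1.sub (LipschitzWith.const b)
      have h3 := (LipschitzWith.const (b + s)).sub h1
      simpa using h2.min h3
    have hd' := (hd.const_max 0).weaken hC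
    have h := hW.min hd'
    rwa [mul_one, max_self] at h
  nonneg p := le_min (sawtooth_nonneg N _) (le_max_left _ _)
  le p := (min_le_left _ _).trans (sawtooth_le hα hβ hL hm N _)
  zero p hp := bump_eq_zero hα hβ hL hN fun h => hp (openBox_subset_closedBox _ _ _ _ h)
  slope p t ht := by
    have := bump_slope (L := L) (a := a) (N := N) (b := b) (s := s) hα hβ p ht
    have := mul_le_mul_of_nonneg_right hβ1 ht
    linarith
  vert p q h1 h2 h3 h4 hpq := by
    have hle := sawtooth_le (a := a) hα hβ hL hm N (q 0)
    rw [bump, bump, hpq, min_eq_left, min_eq_left] <;>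
      exact le_max_of_le_right (le_min (by linarith) (by linarith))

end Bump

lemma bijective_shear {u : Plane → ℝ} {β m : ℝ} (hu : Continuous u) (h0 : ∀ p, 0 ≤ u p)
    (hm : ∀ p, u p ≤ m) (hβ : β < 1) (hs : ∀ p t, 0 ≤ t → u p - β * t ≤ u (p + t • e2 0)) :
    Function.Bijective fun p => p + u p • e2 0 := by
  have hmono : ∀ y, StrictMono fun x => x + u (pt x y) := by
    intro y x x' hx
    have h := hs (pt x y) (x' - x) (by linarith)
    rw [show pt x y + (x' - x) • e2 0 = pt x' y by apply plane_ext <;> simp] at h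
    have := mul_lt_mul_of_pos_right hβ (sub_pos.2 hx)
    simp only
    linarith
  have hpt : ∀ p : Plane, pt (p 0) (p 1) = p := fun p => by apply plane_ext <;> simp
  constructor
  · intro p q hpq
    have e0 := congrArg (fun v : Plane => v 0) hpq
    have e1 := congrArg (fun v : Plane => v 1) hpq
    simp only [PiLp.add_apply, PiLp.smul_apply, e2_zero_zero, e2_zero_one, smul_eq_mul,
      mul_one, mul_zero, add_zero] at e0 e1
    refine plane_ext ((hmono (q 1)).injective ?_) e1
    simp only
    rw [hpt, ← e1, hpt, e0]
  · intro q
    have hc : Continuous fun x => x + u (pt x (q 1)) := by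
      have : Continuous fun x : ℝ => pt x (q 1) := by unfold pt; fun_prop
      fun_prop
    have := mem_range_of_exists_le_of_exists_ge hc (c := q 0)
      ⟨q 0 - m, by linarith [hm (pt (q 0 - m) (q 1))]⟩ ⟨q 0, by linarith [h0 (pt (q 0) (q 1))]⟩
    obtain ⟨x, hx⟩ := this
    refine ⟨pt x (q 1), plane_ext ?_ ?_⟩ <;> simp [hx]

lemma perturb_eq_comp (P : Plane →ᵃ[ℝ] Plane) (u : Plane → ℝ) :
    perturb P u = P ∘ fun p => p + u p • e2 0 := by
  ext1 p
  rw [Function.comp_apply, add_comm p, ← vadd_eq_add, P.map_vadd, perturb, vadd_eq_add, add_comm,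
    map_smul]

lemma exists_homeomorph_perturb {P : Plane →ᵃ[ℝ] Plane} (hP : Function.Bijective P.linear)
    {u : Plane → ℝ} {β m : ℝ} (hu : Continuous u) (h0 : ∀ p, 0 ≤ u p)
    (hm : ∀ p, u p ≤ m) (hβ : β < 1) (hs : ∀ p t, 0 ≤ t → u p - β * t ≤ u (p + t • e2 0)) :
    ∃ g : Plane ≃ₜ Plane, ⇑g = perturb P u := by
  have hbij := bijective_shear hu h0 hm hβ hs
  have hcont : Continuous fun p => p + u p • e2 0 := by fun_prop
  have hproper : IsProperMap fun p => p + u p • e2 0 := by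
    refine isProperMap_iff_isCompact_preimage.2 ⟨hcont, fun K hK => ?_⟩
    refine Metric.isCompact_of_isClosed_isBounded (hK.isClosed.preimage hcont)
      ((hK.isBounded.cthickening (δ := m)).subset fun p hp => ?_)
    refine Metric.mem_cthickening_of_dist_le p _ m K hp ?_
    rw [dist_self_add_right, norm_smul, norm_e2, mul_one, Real.norm_of_nonneg (h0 p)]
    exact hm p
  let e :=
    (AffineEquiv.ofBijective (P.linear_bijective_iff.1 hP)).toContinuousAffineEquiv.toHomeomorph
  refine ⟨((Equiv.ofBijective _ hbij).toHomeomorphOfContinuousClosed hcont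
    hproper.isClosedMap).trans e, ?_⟩
  rw [perturb_eq_comp]
  rfl

lemma isHomeoOn_perturb {P : Plane →ᵃ[ℝ] Plane} (hP : Function.Bijective P) {u : Plane → ℝ}
    {g : Plane ≃ₜ Plane} (hg : ⇑g = perturb P u) {U : Set Plane} (hu : ∀ p ∉ U, u p = 0) :
    IsHomeoOn (perturb P u) g.symm U (P '' U) := by
  have himage : perturb P u '' U = P '' U := by
    have h : perturb P u '' Uᶜ = P '' Uᶜ :=
      image_congr fun p hp => by rw [perturb, hu p hp, zero_smul, add_zero]
    rwa [image_compl_eq hP, image_compl_eq (hg ▸ g.bijective), compl_inj_iff] at h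
  rw [← hg] at himage ⊢
  refine ⟨himage ▸ g.injective.injOn.bijOn_image, g.continuous.continuousOn,
    ⟨fun p _ => g.symm_apply_apply p, fun p _ => g.apply_symm_apply p⟩,
    g.symm.continuous.continuousOn⟩

/-- The values of the bump on the triangles of a cell with corner at the origin. -/
def cellBump (α β l r s x y : ℝ) : Fin 6 → ℝ :=
  ![y, s - y, α * x, α * x, β * (l + r - x), β * (l + r - x)]

section Triangulation

variable {α β l r m s : ℝ}

lemma min_eq_cellBump (hl : 0 < l) (hr : 0 < r) (hm : 0 < m) (hs : 2 * m < s) (hα : α * l = m)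
    (hβ : β * r = m) {x y : ℝ} {i : Fin 6} (h : cellRegion l r m s x y i) :
    min (min (α * x) (β * (l + r - x))) (max 0 (min y (s - y))) = cellBump α β l r s x y i := by
  obtain ⟨⟨-, -⟩, hy, hy'⟩ := cellRegion_box hl hr hm hs h
  rw [max_eq_right (le_min hy (by linarith))]
  have hlα : ∀ t, l * (α * t) = m * t := fun t => by rw [← hα]; ring
  have hrβ : ∀ t, r * (β * t) = m * t := fun t => by rw [← hβ]; ring
  have hlr : 0 < l + r := by positivity
  have hsm : 0 < s - 2 * m := by linarith
  fin_cases i <;> simp only [cellRegion] at h <;> obtain ⟨h1, h2, h3⟩ := h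
  · have e1 : y ≤ α * x := le_of_mul_le_mul_left (by rwa [hlα]) hl
    have e2 : y ≤ β * (l + r - x) := le_of_mul_le_mul_left (by rwa [hrβ]) hr
    have e3 : y ≤ m := le_of_mul_le_mul_left (by linarith) hlr
    change _ = y
    rw [min_eq_left (by linarith : y ≤ s - y), min_eq_right (le_min e1 e2)]
  · have e1 : s - y ≤ α * x := le_of_mul_le_mul_left (by rwa [hlα]) hl
    have e2 : s - y ≤ β * (l + r - x) := le_of_mul_le_mul_left (by rwa [hrβ]) hr
    have e3 : s - y ≤ m := le_of_mul_le_mul_left (by linarith) hlr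
    change _ = s - y
    rw [min_eq_right (by linarith : s - y ≤ y), min_eq_right (le_min e1 e2)]
  · have e0 : x ≤ l := le_of_mul_le_mul_left (by linarith) (by linarith : 0 < s)
    have e1 : α * x ≤ y := le_of_mul_le_mul_left (by rwa [hlα]) hl
    have e2 : α * x ≤ s - y := le_of_mul_le_mul_left (by rw [hlα]; nlinarith) hl
    have e3 : α * x ≤ m := le_of_mul_le_mul_left (by rw [hlα]; nlinarith) hl
    have e4 : m ≤ β * (l + r - x) := le_of_mul_le_mul_left (by rw [hrβ]; nlinarith) hr
    change _ = α * x
    rw [min_eq_left (e3.trans e4), min_eq_left (le_min e1 e2)]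
  · have e1 : α * x ≤ s - y := le_of_mul_le_mul_left (by rwa [hlα]) hl
    have e2 : α * x ≤ y := le_of_mul_le_mul_left (by rw [hlα]; nlinarith) hl
    have e3 : α * x ≤ m := le_of_mul_le_mul_left (by rw [hlα]; nlinarith) hl
    have e4 : m ≤ β * (l + r - x) := le_of_mul_le_mul_left (by rw [hrβ]; nlinarith) hr
    change _ = α * x
    rw [min_eq_left (e3.trans e4), min_eq_left (le_min e2 e1)]
  · have e0 : l + r - x ≤ r := le_of_mul_le_mul_left (by linarith) (by linarith : 0 < s)
    have e1 : β * (l + r - x) ≤ y := le_of_mul_le_mul_left (by rwa [hrβ]) hr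
    have e2 : β * (l + r - x) ≤ s - y := le_of_mul_le_mul_left (by rw [hrβ]; nlinarith) hr
    have e3 : β * (l + r - x) ≤ m := le_of_mul_le_mul_left (by rw [hrβ]; nlinarith) hr
    have e4 : m ≤ α * x := le_of_mul_le_mul_left (by rw [hlα]; nlinarith) hl
    change _ = β * (l + r - x)
    rw [min_eq_right (e3.trans e4), min_eq_left (le_min e1 e2)]
  · have e1 : β * (l + r - x) ≤ s - y := le_of_mul_le_mul_left (by rwa [hrβ]) hr
    have e2 : β * (l + r - x) ≤ y := le_of_mul_le_mul_left (by rw [hrβ]; nlinarith) hr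
    have e3 : β * (l + r - x) ≤ m := le_of_mul_le_mul_left (by rw [hrβ]; nlinarith) hr
    have e4 : m ≤ α * x := le_of_mul_le_mul_left (by rw [hlα]; nlinarith) hl
    change _ = β * (l + r - x)
    rw [min_eq_right (e3.trans e4), min_eq_left (le_min e2 e1)]

/-- The triangles of the `k`-th cell of a subdivision of `[a, a + N (l + r)] × [b, b + s]`. -/
def gridTriangle (a b l r m s : ℝ) (k : ℕ) (i : Fin 6) : Set Plane :=
  cellTriangle (a + k * (l + r)) b l r m s i

variable {a b : ℝ} {N : ℕ}

lemma bump_eq_cellBump (hl : 0 < l) (hr : 0 < r) (hm : 0 < m) (hs : 2 * m < s) (hα : α * l = m)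
    (hβ : β * r = m) {k : ℕ} (hk : k < N) {i : Fin 6} {q : Plane}
    (hq : q ∈ gridTriangle a b l r m s k i) :
    bump α β (l + r) a N b s q =
      cellBump α β l r s (q 0 - (a + k * (l + r))) (q 1 - b) i := by
  have hα0 : 0 < α := pos_of_mul_pos_left (hα.symm ▸ hm) hl.le
  have hβ0 : 0 < β := pos_of_mul_pos_left (hβ.symm ▸ hm) hr.le
  have h := (mem_cellTriangle_iff hl hr hm hs _ _ _ _).1 hq
  obtain ⟨⟨hx, hx'⟩, -, -⟩ := cellRegion_box hl hr hm hs h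
  rw [bump, sawtooth_eq_tooth hα0 hβ0 (by positivity) hk (by linarith) (by linarith), tooth,
    ← min_eq_cellBump hl hr hm hs hα hβ h]
  ring_nf

lemma interior_gridTriangle_subset (hl : 0 < l) (hr : 0 < r) (hm : 0 < m) (hs : 2 * m < s) (k : ℕ)
    (i : Fin 6) : interior (gridTriangle a b l r m s k i) ⊆
      openBox (a + k * (l + r)) (a + (k + 1) * (l + r)) b (b + s) := by
  refine (interior_mono fun q hq => ?_).trans (interior_closedBox_subset _ _ _ _)
  obtain ⟨⟨h1, h2⟩, h3, h4⟩ :=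
    cellRegion_box hl hr hm hs ((mem_cellTriangle_iff hl hr hm hs _ _ _ _).1 hq)
  exact ⟨by linarith, by linarith, by linarith, by linarith⟩

lemma grid_column_unique {L x : ℝ} (hL : 0 < L) {k k' : ℕ} (h1 : a + k * L < x)
    (h2 : x < a + (k + 1) * L) (h3 : a + k' * L < x) (h4 : x < a + (k' + 1) * L) : k = k' := by
  have e1 : (k : ℝ) < k' + 1 := lt_of_mul_lt_mul_right (by linarith) hL.le
  have e2 : (k' : ℝ) < k + 1 := lt_of_mul_lt_mul_right (by linarith) hL.le
  norm_cast at e1 e2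
  lia

lemma gridTriangle_unique (hl : 0 < l) (hr : 0 < r) (hm : 0 < m) (hs : 2 * m < s) {k k' : ℕ}
    {i i' : Fin 6} {q : Plane} (h : q ∈ interior (gridTriangle a b l r m s k i))
    (h' : q ∈ interior (gridTriangle a b l r m s k' i')) : k = k' ∧ i = i' := by
  obtain ⟨h1, h2, -, -⟩ := interior_gridTriangle_subset hl hr hm hs k i h
  obtain ⟨h3, h4, -, -⟩ := interior_gridTriangle_subset hl hr hm hs k' i' h'
  obtain rfl := grid_column_unique (by positivity) h1 h2 h3 h4
  exact ⟨rfl, cellInterior_inj hl hr hm hs (cellInterior_of_mem_interior hl hr hm hs h)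
    (cellInterior_of_mem_interior hl hr hm hs h')⟩

lemma exists_grid_column {L x : ℝ} (hN : 0 < N) (h : a ≤ x) (h' : x ≤ a + N * L) :
    ∃ k < N, a + k * L ≤ x ∧ x ≤ a + (k + 1) * L := by
  induction N, hN using Nat.le_induction with
  | base => exact ⟨0, one_pos, by simpa using h, by simpa using h'⟩
  | succ n hn ih =>
    rcases le_total x (a + n * L) with hx | hx
    · obtain ⟨k, hk, hk'⟩ := ih hx
      exact ⟨k, by lia, hk'⟩
    · exact ⟨n, by lia, hx, by exact_mod_cast h'⟩

lemma iUnion_gridTriangle (hl : 0 < l) (hr : 0 < r) (hm : 0 < m) (hs : 2 * m < s) (hN0 : 0 < N)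
    (hN : N * (l + r) = s) :
    ⋃ k : Fin N × Fin 6, gridTriangle a b l r m s k.1 k.2 = closedBox a (a + s) b (b + s) := by
  apply subset_antisymm
  · refine iUnion_subset fun k q hq => ?_
    obtain ⟨⟨h1, h2⟩, h3, h4⟩ :=
      cellRegion_box hl hr hm hs ((mem_cellTriangle_iff hl hr hm hs _ _ _ _).1 hq)
    have hk : ((k.1 : ℕ) : ℝ) + 1 ≤ N := by exact_mod_cast k.1.2
    have hk' := mul_le_mul_of_nonneg_right hk (add_pos hl hr).le
    have hk0 : 0 ≤ ((k.1 : ℕ) : ℝ) * (l + r) := by positivity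
    exact ⟨by linarith, by linarith, by linarith, by linarith⟩
  · rintro q ⟨h1, h2, h3, h4⟩
    obtain ⟨k, hk, hx, hx'⟩ := exists_grid_column hN0 h1 (hN.symm ▸ h2)
    obtain ⟨i, hi⟩ := exists_cellRegion (x := q 0 - (a + k * (l + r))) (y := q 1 - b) hl hr hm
      (s := s) (by linarith) (by linarith) (by linarith) (by linarith)
    exact mem_iUnion.2 ⟨(⟨k, hk⟩, i), (mem_cellTriangle_iff hl hr hm hs _ _ _ _).2 hi⟩

lemma exists_affineMap_perturb (P : Plane →ᵃ[ℝ] Plane) {u : Plane → ℝ} {S : Set Plane} {A B c : ℝ}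
    (hu : ∀ q ∈ S, u q = A * q 0 + B * q 1 + c) :
    ∃ T : Plane →ᵃ[ℝ] Plane, EqOn (perturb P u) T S := by
  let f : Plane →ᵃ[ℝ] ℝ := (A • EuclideanSpace.projₗ 0 + B • EuclideanSpace.projₗ 1 :
    Plane →ₗ[ℝ] ℝ).toAffineMap + AffineMap.const ℝ Plane c
  refine ⟨P + (LinearMap.toSpanSingleton ℝ Plane (P.linear (e2 0))).toAffineMap.comp f,
    fun q hq => ?_⟩
  simp [perturb, hu q hq, f, add_smul]

lemma piecewiseAffineOn_perturb (P : Plane →ᵃ[ℝ] Plane) (hl : 0 < l) (hr : 0 < r) (hm : 0 < m)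
    (hs : 2 * m < s) (hα : α * l = m) (hβ : β * r = m) (hN0 : 0 < N) (hN : N * (l + r) = s) :
    PiecewiseAffineOn (perturb P (bump α β (l + r) a N b s)) (openBox a (a + s) b (b + s)) := by
  have hs0 : 0 < s := by linarith
  let T (j : Fin (N * 6)) : Set Plane :=
    gridTriangle a b l r m s (finProdFinEquiv.symm j).1 (finProdFinEquiv.symm j).2
  refine ⟨N * 6, T, fun j => isClosedTriangle_cellTriangle _ _ _ _ _ _ _, fun j j' hj => ?_, ?_,
    fun j => ?_⟩
  · refine Set.disjoint_left.2 fun q hq hq' => hj ?_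
    obtain ⟨h1, h2⟩ := gridTriangle_unique hl hr hm hs hq hq'
    exact finProdFinEquiv.symm.injective (Prod.ext (Fin.ext h1) h2)
  · rw [closure_openBox (by linarith) (by linarith), ← iUnion_gridTriangle hl hr hm hs hN0 hN]
    exact finProdFinEquiv.symm.surjective.iUnion_comp
      fun k : Fin N × Fin 6 => gridTriangle a b l r m s k.1 k.2
  · have key : ∃ A B c : ℝ, ∀ q ∈ T j, bump α β (l + r) a N b s q = A * q 0 + B * q 1 + c := by
      have h := fun q => bump_eq_cellBump (a := a) (b := b) (q := q) hl hr hm hs hα hβ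
        (finProdFinEquiv.symm j).1.2 (i := (finProdFinEquiv.symm j).2)
      change ∀ q, q ∈ T j → _ at h
      generalize (finProdFinEquiv.symm j).2 = i at h
      generalize a + ((finProdFinEquiv.symm j).1 : ℕ) * (l + r) = x₀ at h
      fin_cases i
      · exact ⟨0, 1, -b, fun q hq => (h q hq).trans (by simp [cellBump]; ring)⟩
      · exact ⟨0, -1, s + b, fun q hq => (h q hq).trans (by simp [cellBump]; ring)⟩
      · exact ⟨α, 0, -(α * x₀), fun q hq => (h q hq).trans (by simp [cellBump]; ring)⟩
      · exact ⟨α, 0, -(α * x₀), fun q hq => (h q hq).trans (by simp [cellBump]; ring)⟩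
      · exact ⟨-β, 0, β * (l + r + x₀), fun q hq => (h q hq).trans (by simp [cellBump]; ring)⟩
      · exact ⟨-β, 0, β * (l + r + x₀), fun q hq => (h q hq).trans (by simp [cellBump]; ring)⟩
    obtain ⟨A, B, c, h⟩ := key
    exact exists_affineMap_perturb P fun q hq => h q hq.2

end Triangulation

lemma volume_image_affineMap (P : Plane →ᵃ[ℝ] Plane) (S : Set Plane) :
    volume (P '' S) = ENNReal.ofReal |P.linear.det| * volume S := by
  have : ⇑P = (fun v => v + P 0) ∘ P.linear := by
    ext1 p
    exact congrFun P.decomp p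
  rw [this, image_comp, image_add_right, measure_preimage_add_right,
    Measure.addHaar_image_linearMap]

section Left

variable {α β l r m s a b : ℝ} {N : ℕ}

/-- The union of the open triangles of the grid on which the bump increases. -/
def leftTriangles (a b l r m s : ℝ) (N : ℕ) : Set Plane :=
  ⋃ k : Fin N × Fin 2, interior (gridTriangle a b l r m s k.1 (![2, 3] k.2))

lemma isOpen_leftTriangles : IsOpen (leftTriangles a b l r m s N) :=
  isOpen_iUnion fun _ => isOpen_interior

lemma finUnionTriangles_leftTriangles (hl : 0 < l) (hr : 0 < r) (hm : 0 < m) (hs : 2 * m < s) :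
    FinUnionTriangles (leftTriangles a b l r m s N) := by
  refine ⟨N * 2, fun j => interior (gridTriangle a b l r m s (finProdFinEquiv.symm j).1
    (![2, 3] (finProdFinEquiv.symm j).2)), fun j => ?_, fun j j' hj => ?_, ?_⟩
  · obtain ⟨x, y, z, h⟩ := isClosedTriangle_cellTriangle
      (a + ((finProdFinEquiv.symm j).1 : ℕ) * (l + r)) b l r m s
      (![2, 3] (finProdFinEquiv.symm j).2)
    exact ⟨x, y, z, congrArg interior h⟩
  · refine Set.disjoint_left.2 fun q hq hq' => hj ?_
    obtain ⟨h1, h2⟩ := gridTriangle_unique hl hr hm hs hq hq'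
    have hinj : Function.Injective (![2, 3] : Fin 2 → Fin 6) := by decide
    exact finProdFinEquiv.symm.injective (Prod.ext (Fin.ext h1) (hinj h2))
  · exact (finProdFinEquiv.symm.surjective.iUnion_comp fun k : Fin N × Fin 2 =>
      interior (gridTriangle a b l r m s k.1 (![2, 3] k.2))).symm

lemma leftTriangles_subset (hl : 0 < l) (hr : 0 < r) (hm : 0 < m) (hs : 2 * m < s)
    (hN : N * (l + r) = s) : leftTriangles a b l r m s N ⊆ openBox a (a + s) b (b + s) := by
  refine iUnion_subset fun k q hq => ?_
  obtain ⟨h1, h2, h3, h4⟩ := interior_gridTriangle_subset hl hr hm hs _ _ hq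
  have hk : ((k.1 : ℕ) : ℝ) + 1 ≤ N := by exact_mod_cast k.1.2
  have hk' := mul_le_mul_of_nonneg_right hk (add_pos hl hr).le
  have hk0 : 0 ≤ ((k.1 : ℕ) : ℝ) * (l + r) := by positivity
  exact ⟨by linarith, by linarith, h3, h4⟩

lemma volume_leftTriangles_le (hl : 0 < l) (hr : 0 < r) (hm : 0 < m) (hs : 2 * m < s) :
    volume (leftTriangles a b l r m s N) ≤ ENNReal.ofReal (N * (l * s)) := by
  have hs0 : 0 < s := by linarith
  have hsub : leftTriangles a b l r m s N ⊆
      ⋃ k : Fin N, closedBox (a + k * (l + r)) (a + k * (l + r) + l) b (b + s) := by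
    refine iUnion_subset fun k q hq => mem_iUnion.2 ⟨k.1, ?_⟩
    obtain ⟨-, -, h3, h4⟩ := interior_gridTriangle_subset hl hr hm hs _ _ hq
    have h := cellInterior_of_mem_interior hl hr hm hs hq
    have h' : 0 < q 0 - (a + (k.1 : ℕ) * (l + r)) ∧ q 0 - (a + (k.1 : ℕ) * (l + r)) < l := by
      obtain ⟨k, j⟩ := k
      have : (![2, 3] j : Fin 6) = 2 ∨ (![2, 3] j : Fin 6) = 3 := by fin_cases j <;> simp
      have := cellInterior_left (y := q 1 - b) hm hs (this.imp (fun e => e ▸ h) fun e => e ▸ h)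
      exact ⟨this.1, this.2.1⟩
    exact ⟨by linarith, by linarith, by linarith, by linarith⟩
  calc volume (leftTriangles a b l r m s N)
      ≤ ∑ k : Fin N, volume (closedBox (a + k * (l + r)) (a + k * (l + r) + l) b (b + s)) :=
        (measure_mono hsub).trans (measure_iUnion_fintype_le _ _)
    _ = ENNReal.ofReal (N * (l * s)) := by
        simp_rw [volume_closedBox, add_sub_cancel_left]
        rw [Finset.sum_const, Finset.card_univ, Fintype.card_fin, nsmul_eq_mul,
          ENNReal.ofReal_mul (by positivity), ENNReal.ofReal_mul hl.le, ENNReal.ofReal_natCast]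

lemma le_volume_leftTriangles (hl : 0 < l) (hr : 0 < r) (hm : 0 < m) (hs : 2 * m < s) :
    ENNReal.ofReal (N * (l * (s - 2 * m))) ≤ volume (leftTriangles a b l r m s N) := by
  let R (k : Fin N) : Set Plane :=
    openBox (a + k * (l + r)) (a + k * (l + r) + l) (b + m) (b + s - m)
  have hR : Pairwise (Function.onFun Disjoint R) := by
    intro k k' hk
    refine Set.disjoint_left.2 fun q hq hq' => hk (Fin.ext ?_)
    exact grid_column_unique (add_pos hl hr) hq.1 (by linarith [hq.2.1]) hq'.1
      (by linarith [hq'.2.1])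
  have hsub : ⋃ k, R k ⊆ leftTriangles a b l r m s N ∪
      ⋃ k : Fin N × Fin 2, frontier (gridTriangle a b l r m s k.1 (![2, 3] k.2)) := by
    refine iUnion_subset fun k q hq => ?_
    obtain ⟨h1, h2, h3, h4⟩ := hq
    have key : ∃ j : Fin 2, q ∈ gridTriangle a b l r m s k (![2, 3] j) := by
      have e1 : m * (q 0 - (a + k * (l + r))) ≤ l * (q 1 - b) := by nlinarith
      have e2 : m * (q 0 - (a + k * (l + r))) ≤ l * (s - (q 1 - b)) := by nlinarith
      rcases le_total ((s - m) * (q 0 - (a + k * (l + r)))) (l * (s - (q 1 - b))) with h | h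
      · exact ⟨0, (mem_cellTriangle_iff hl hr hm hs _ _ 2 _).2 ⟨by linarith, e1, h⟩⟩
      · exact ⟨1, (mem_cellTriangle_iff hl hr hm hs _ _ 3 _).2 ⟨by linarith, e2, h⟩⟩
    obtain ⟨j, hj⟩ := key
    have := subset_closure hj
    rw [closure_eq_interior_union_frontier] at this
    exact this.imp (fun h => mem_iUnion.2 ⟨(k, j), h⟩) fun h => mem_iUnion.2 ⟨(k, j), h⟩
  have hnull : volume (⋃ k : Fin N × Fin 2,
      frontier (gridTriangle a b l r m s k.1 (![2, 3] k.2))) = 0 := by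
    refine measure_iUnion_null fun k => ?_
    obtain ⟨x, y, z, h⟩ := isClosedTriangle_cellTriangle
      (a + (k.1 : ℕ) * (l + r)) b l r m s (![2, 3] k.2)
    rw [gridTriangle, h]
    exact (convex_convexHull ℝ _).addHaar_frontier _
  calc ENNReal.ofReal (N * (l * (s - 2 * m)))
      = ∑ k, volume (R k) := by
        simp_rw [R, volume_openBox, add_sub_cancel_left,
          show b + s - m - (b + m) = s - 2 * m by ring]
        rw [Finset.sum_const, Finset.card_univ, Fintype.card_fin, nsmul_eq_mul,
          ENNReal.ofReal_mul (by positivity), ENNReal.ofReal_mul hl.le, ENNReal.ofReal_natCast]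
    _ = volume (⋃ k, R k) := by
        rw [measure_iUnion hR fun k => (isOpen_openBox _ _ _ _).measurableSet, tsum_fintype]
    _ ≤ volume (leftTriangles a b l r m s N) :=
        (measure_mono hsub).trans ((measure_union_le _ _).trans (by rw [hnull, add_zero]))

lemma volume_perturb_image_leftTriangles (P : Plane →ᵃ[ℝ] Plane) (hl : 0 < l) (hr : 0 < r)
    (hm : 0 < m) (hs : 2 * m < s) (hα : α * l = m) (hβ : β * r = m)
    (hinj : Function.Injective (perturb P (bump α β (l + r) a N b s))) :
    volume (perturb P (bump α β (l + r) a N b s) '' leftTriangles a b l r m s N) =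
      ENNReal.ofReal |P.linear.det| *
        (ENNReal.ofReal (1 + α) * volume (leftTriangles a b l r m s N)) := by
  have hα0 : 0 < α := pos_of_mul_pos_left (hα.symm ▸ hm) hl.le
  rw [perturb_eq_comp] at hinj
  rw [perturb_eq_comp, image_comp, volume_image_affineMap]
  congr 1
  let D : Plane →L[ℝ] Plane :=
    (LinearMap.transvection (EuclideanSpace.projₗ 0) (α • e2 0)).toContinuousLinearMap
  have hD : D.det = 1 + α := by
    change LinearMap.det (D : Plane →ₗ[ℝ] Plane) = _
    rw [LinearMap.coe_toContinuousLinearMap, LinearMap.transvection.det]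
    simp
  have hderiv : ∀ q ∈ leftTriangles a b l r m s N, HasFDerivWithinAt
      (fun p => p + bump α β (l + r) a N b s p • e2 0) D (leftTriangles a b l r m s N) q := by
    intro q hq
    obtain ⟨⟨k, j⟩, hk⟩ := mem_iUnion.1 hq
    refine HasFDerivAt.hasFDerivWithinAt ?_
    have h : HasFDerivAt (fun p => D p - (α * (a + k * (l + r))) • e2 0) D q :=
      D.hasFDerivAt.sub_const _
    refine h.congr_of_eventuallyEq ?_
    filter_upwards [isOpen_interior.mem_nhds hk] with p hp
    have hc : ∀ x y, cellBump α β l r s x y (![2, 3] j) = α * x := by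
      intro x y
      fin_cases j <;> rfl
    rw [bump_eq_cellBump hl hr hm hs hα hβ k.2 (interior_subset hp), hc]
    simp only [D, LinearMap.coe_toContinuousLinearMap', LinearMap.transvection.apply]
    apply plane_ext
    · simp; ring
    · simp
  rw [← lintegral_abs_det_fderiv_eq_addHaar_image volume isOpen_leftTriangles.measurableSet hderiv
    hinj.of_comp.injOn, hD, lintegral_const, Measure.restrict_apply_univ,
    abs_of_pos (by positivity)]

end Left

lemma exists_cell_sizes {n : ℕ} (hn : 1 ≤ n) {s : ℝ} (hs : 0 < s) {δ : ℝ} (hδ : δ * (2 * n) = 1)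
    {m₀ : ℝ} (hm₀ : 0 < m₀) : ∃ (N : ℕ) (l r m : ℝ), 0 < N ∧ 0 < l ∧ 0 < r ∧ 0 < m ∧ m ≤ m₀ ∧
      2 * m < s ∧ (1 - δ) ^ 2 / δ * l = m ∧ (1 - δ) * r = m ∧ N * (l + r) = s ∧
      N * (l * s) < s ^ 2 / n ∧
      (1 - 1 / n) * s ^ 2 < (1 + (1 - δ) ^ 2 / δ) * (N * (l * (s - 2 * m))) := by
  have hn' : (1 : ℝ) ≤ n := by exact_mod_cast hn
  have hδ0 : 0 < δ := pos_of_mul_pos_left (hδ.symm ▸ one_pos) (by positivity)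
  have hδ1 : δ ≤ 1 / 2 := by nlinarith
  obtain ⟨N, hN⟩ := exists_nat_gt (max (s / m₀) (4 * n))
  obtain ⟨hN1, hN2⟩ := max_lt_iff.1 hN
  have hN0 : (0 : ℝ) < N := by linarith
  have hL : N * (s / N) = s := by field_simp
  have hL0 : 0 < s / N := by positivity
  have hm : (1 - δ) ^ 2 * (s / N) ≤ s / N := mul_le_of_le_one_left hL0.le (by nlinarith)
  have hLm : s / N ≤ m₀ := by
    rw [div_le_iff₀ hN0]
    rw [div_lt_iff₀ hm₀] at hN1
    linarith
  have hLs : 2 * (s / N) < δ * s := by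
    rw [← mul_div_assoc, div_lt_iff₀ hN0]
    nlinarith [mul_pos hδ0 hs]
  have hn1 : 1 / (n : ℝ) = 2 * δ := by
    rw [div_eq_iff (by positivity)]
    linarith
  refine ⟨N, δ * (s / N), (1 - δ) * (s / N), (1 - δ) ^ 2 * (s / N), by exact_mod_cast hN0,
    by positivity, mul_pos (by linarith) hL0, mul_pos (pow_pos (by linarith) 2) hL0, by linarith,
    by nlinarith, by field_simp, by ring, by linear_combination hL, ?_, ?_⟩
  · rw [div_eq_mul_one_div (s ^ 2), hn1]
    calc N * (δ * (s / N) * s) = s ^ 2 * δ := by field_simp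
      _ < s ^ 2 * (2 * δ) := by nlinarith [mul_pos (pow_pos hs 2) hδ0]
  · rw [hn1]
    calc (1 - 2 * δ) * s ^ 2 < (1 - δ + δ ^ 2) * (1 - δ) * s ^ 2 := by
          have : 1 - 2 * δ < (1 - δ + δ ^ 2) * (1 - δ) := by nlinarith [pow_pos hδ0 2]
          gcongr
      _ = (1 - δ + δ ^ 2) * s * (s - δ * s) := by ring
      _ ≤ (1 - δ + δ ^ 2) * s * (s - 2 * ((1 - δ) ^ 2 * (s / N))) := by
          have : 0 ≤ 1 - δ + δ ^ 2 := by nlinarith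
          refine mul_le_mul_of_nonneg_left (by linarith) (by positivity)
      _ = (1 + (1 - δ) ^ 2 / δ) * (N * (δ * (s / N) * (s - 2 * ((1 - δ) ^ 2 * (s / N))))) := by
          field_simp
          ring

lemma exists_building_block {P : Plane →ᵃ[ℝ] Plane} (hP : Function.Bijective P.linear) (a b : ℝ)
    {s : ℝ} (hs : 0 < s) {n : ℕ} (hn : 1 ≤ n) :
    ∃ (h hinv : Plane → Plane) (F : Set Plane),
      PiecewiseAffineOn h (openBox a (a + s) b (b + s)) ∧
      IsHomeoOn h hinv (openBox a (a + s) b (b + s)) (P '' openBox a (a + s) b (b + s)) ∧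
      ContinuousOn h (closure (openBox a (a + s) b (b + s))) ∧
      EqOn h P (frontier (openBox a (a + s) b (b + s))) ∧
      |Var h (openBox a (a + s) b (b + s)) - Var P (openBox a (a + s) b (b + s))| ≤
        (1 / n : ℝ) * Var P (openBox a (a + s) b (b + s)) ∧
      F ⊆ openBox a (a + s) b (b + s) ∧ FinUnionTriangles F ∧
      volume F < volume (openBox a (a + s) b (b + s)) / (n : ℝ≥0∞) ∧
      (1 - 1 / (n : ℝ≥0∞)) * volume (P '' openBox a (a + s) b (b + s)) < volume (h '' F) := by
  have hn' : (1 : ℝ) ≤ n := by exact_mod_cast hn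
  obtain ⟨δ, hδ⟩ : ∃ δ : ℝ, δ * (2 * n) = 1 := ⟨1 / (2 * n), by field_simp⟩
  have hδ0 : 0 < δ := pos_of_mul_pos_left (hδ.symm ▸ one_pos) (by positivity)
  have hδ1 : δ ≤ 1 / 2 := by nlinarith
  have hβ0 : 0 < 1 - δ := by linarith
  have hβ1 : 1 - δ < 1 := by linarith
  have hα0 : 0 < (1 - δ) ^ 2 / δ := by positivity
  obtain ⟨C, hC⟩ : ∃ C : ℝ≥0, (C : ℝ) = (1 - δ) ^ 2 / δ + 1 := ⟨⟨_, by positivity⟩, rfl⟩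
  obtain ⟨m₀, hm₀, hVar⟩ := exists_abs_Var_perturb_sub_le hP a b hs C
    (show 0 < 1 / (n : ℝ) by positivity)
  obtain ⟨N, l, r, m, hN0, hl, hr, hm, hmm₀, hms, hα, hβ, hN, hF, hhF⟩ :=
    exists_cell_sizes hn hs hδ hm₀
  generalize (1 - δ) ^ 2 / δ = α at *
  generalize 1 - δ = β at *
  have hu : IsSmallBump a b s m C (bump α β (l + r) a N b s) := by
    have h1 : (1 : ℝ) ≤ C := by linarith
    exact isSmallBump_bump hα0 hβ0 hβ1.le (by linarith) (by exact_mod_cast h1) (by positivity) hN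
      (by linear_combination (-β) * hα - α * hβ)
  have hoff : ∀ p ∉ openBox a (a + s) b (b + s), bump α β (l + r) a N b s p = 0 :=
    fun p hp => bump_eq_zero hα0 hβ0 (by positivity) hN hp
  obtain ⟨g, hg⟩ := exists_homeomorph_perturb hP hu.lip.continuous hu.nonneg hu.le hβ1
    fun p t ht => bump_slope hα0 hβ0 p ht
  have hvol : volume (openBox a (a + s) b (b + s)) = ENNReal.ofReal (s ^ 2) := by
    rw [volume_openBox, add_sub_cancel_left, add_sub_cancel_left, ← ENNReal.ofReal_mul hs.le, sq]
  have hdet : 0 < |P.linear.det| := by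
    rw [abs_pos, ← isUnit_iff_ne_zero]
    exact ((Module.End.isUnit_iff _).2 hP).map LinearMap.det
  refine ⟨perturb P (bump α β (l + r) a N b s), g.symm, leftTriangles a b l r m s N,
    piecewiseAffineOn_perturb P hl hr hm hms hα hβ hN0 hN,
    isHomeoOn_perturb (P.linear_bijective_iff.1 hP) hg hoff, hg ▸ g.continuous.continuousOn,
    fun p hp => ?_, hVar m _ hm.le hmm₀ hu, leftTriangles_subset hl hr hm hms hN,
    finUnionTriangles_leftTriangles hl hr hm hms, ?_, ?_⟩
  · rw [(isOpen_openBox _ _ _ _).frontier_eq] at hp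
    rw [perturb, hoff p hp.2, zero_smul, add_zero]
  · refine (volume_leftTriangles_le hl hr hm hms).trans_lt ?_
    rw [hvol, ← ENNReal.ofReal_natCast n, ← ENNReal.ofReal_div_of_pos (by positivity)]
    exact (ENNReal.ofReal_lt_ofReal_iff (by positivity)).2 hF
  · rw [volume_image_affineMap, hvol,
      volume_perturb_image_leftTriangles P hl hr hm hms hα hβ (hg ▸ g.injective), mul_left_comm]
    refine ENNReal.mul_lt_mul_right (by simpa using hdet) ENNReal.ofReal_ne_top ?_
    have hle := mul_le_mul_right (le_volume_leftTriangles (a := a) (b := b) (N := N) hl hr hm hms)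
      (ENNReal.ofReal (1 + α))
    refine lt_of_lt_of_le ?_ hle
    have h1 : (1 - 1 / (n : ℝ≥0∞)) = ENNReal.ofReal (1 - 1 / n) := by
      rw [ENNReal.ofReal_sub _ (by positivity), ENNReal.ofReal_div_of_pos (by positivity),
        ENNReal.ofReal_one, ENNReal.ofReal_natCast]
    have h2 : 0 ≤ 1 - 1 / (n : ℝ) := sub_nonneg.2 ((div_le_one (by positivity)).2 hn')
    rw [h1, ← ENNReal.ofReal_mul h2, ← ENNReal.ofReal_mul (by positivity)]
    exact (ENNReal.ofReal_lt_ofReal_iff_of_nonneg (by positivity)).2 hhF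

/-- for every affine homeomorphism `P` on an open axis-parallel square
`Q0` and every `n ≥ 1` there is a piecewise affine homeomorphism `h : Q0 → P(Q0)`
agreeing with `P` on `∂Q0`, whose variation differs from that of `P` by at most
`(1/n)·Var(P,Q0)`, together with a finite union `F` of pairwise disjoint open
triangles in `Q0` with `|F|/|Q0| < 1/n` and `|h(F)|/|P(Q0)| > 1 - 1/n`. -/
theorem building_block (P : Plane →ᵃ[ℝ] Plane) (hP : Function.Bijective P.linear)
    (Q0 : Set Plane) (hQ0 : IsOpenAxisSquare Q0) (n : ℕ) (hn : 1 ≤ n) :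
    ∃ (h hinv : Plane → Plane) (F : Set Plane),
      PiecewiseAffineOn h Q0 ∧
      IsHomeoOn h hinv Q0 (⇑P '' Q0) ∧
      ContinuousOn h (closure Q0) ∧ EqOn h (⇑P) (frontier Q0) ∧
      |Var h Q0 - Var (⇑P) Q0| ≤ (1 / n : ℝ) * Var (⇑P) Q0 ∧
      F ⊆ Q0 ∧ FinUnionTriangles F ∧
      volume F < volume Q0 / (n : ℝ≥0∞) ∧
      (1 - 1 / (n : ℝ≥0∞)) * volume (⇑P '' Q0) < volume (h '' F) := by
  obtain ⟨a, b, s, hs, rfl⟩ := hQ0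
  exact exists_building_block hP a b hs hn

end
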